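/- The set of pairs (α, β) of real numbers satisfying liminf over integers x, y ≥ 0 (not both zero, |xy| → ∞) of max{2,|xy|}·‖xα+yβ‖·(log max{2,|xy|})² > 0 has Hausdorff dimension 2 in ℝ². -/

import Mathlib

open Filter

noncomputable def nint (y : ℝ) : ℝ := |y - round y|

open MeasureTheory

namespace MB

lemma nint_le (y : ℝ) (p : ℤ) : nint y ≤ |y - p| := round_le y p

lemma nint_nonneg (y : ℝ) : 0 ≤ nint y := abs_nonneg _

lemma nint_le_add (a b : ℝ) : nint a ≤ nint b + |a - b| := by
  have h1 := nint_le a (round b)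
  have h2 : |a - round b| ≤ |a - b| + |b - round b| := abs_sub_le _ _ _
  unfold nint at *
  linarith

lemma nint_add_int (a : ℝ) (p : ℤ) : nint (a + p) = nint a := by
  unfold nint
  rw [round_add_intCast]
  push_cast
  congr 1
  ring

lemma nint_eq_abs {a : ℝ} (h : |a| < 1 / 2) : nint a = |a| := by
  have : round a = 0 := by
    rw [round_eq_zero_iff]
    rw [abs_lt] at h
    constructor <;> linarith [h.1, h.2]
  unfold nint
  rw [this]
  simp

lemma measurable_nint : Measurable nint := by
  unfold nint
  have : Measurable (fun y : ℝ => (round y : ℝ)) := by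
    have h : (fun y : ℝ => (round y : ℝ)) = fun y => ((⌊y + 1/2⌋ : ℤ) : ℝ) := by
      funext y; rw [round_eq]
    rw [h]
    fun_prop
  fun_prop

/-- affine change of variables on the line -/
lemma vol_affine (s c : ℝ) (hs : s ≠ 0) (P : Set ℝ) :
    volume {t : ℝ | s * t + c ∈ P} = ENNReal.ofReal (|s|⁻¹) * volume P := by
  have h : {t : ℝ | s * t + c ∈ P} = (fun t => s * t) ⁻¹' ((fun u => u + c) ⁻¹' P) := rfl
  rw [h, Real.volume_preimage_mul_left hs, measure_preimage_add_right, abs_inv]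

lemma card_near (a b : ℝ) (hab : a ≤ b) :
    ((Finset.Icc ⌈a - 1/2⌉ ⌊b + 1/2⌋).card : ℝ) ≤ b - a + 2 := by
  rw [Int.card_Icc]
  have h1 : (⌊b + 1/2⌋ : ℝ) ≤ b + 1/2 := Int.floor_le _
  have h2 : a - 1/2 ≤ (⌈a - 1/2⌉ : ℝ) := Int.le_ceil _
  have h3 : (((⌊b + 1/2⌋ + 1 - ⌈a - 1/2⌉).toNat : ℤ) : ℝ) ≤ b - a + 2 := by
    rcases le_total 0 (⌊b + 1/2⌋ + 1 - ⌈a - 1/2⌉) with h | h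
    · rw [Int.toNat_of_nonneg h]
      push_cast
      linarith
    · rw [Int.toNat_of_nonpos h]
      push_cast
      linarith
  exact_mod_cast h3

lemma round_mem (a b u : ℝ) (h : u ∈ Set.Icc a b) :
    round u ∈ Finset.Icc ⌈a - 1/2⌉ ⌊b + 1/2⌋ := by
  have h1 := abs_sub_round u
  rw [abs_le] at h1
  rw [Finset.mem_Icc]
  constructor
  · rw [Int.ceil_le]; linarith [h.1]
  · rw [Int.le_floor]; linarith [h.2]

/-- covering by translates of a set around integers -/
lemma vol_cover (a b C : ℝ) (hab : a ≤ b) (hC : 0 ≤ C) (A E : Set ℝ)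
    (hE : volume E ≤ ENNReal.ofReal C)
    (hA : ∀ u ∈ A, u ∈ Set.Icc a b ∧ u - round u ∈ E) :
    volume A ≤ ENNReal.ofReal ((b - a + 2) * C) := by
  have hsub : A ⊆ ⋃ p ∈ Finset.Icc ⌈a - 1/2⌉ ⌊b + 1/2⌋, (fun u : ℝ => u + (-(p : ℝ))) ⁻¹' E := by
    intro u hu
    obtain ⟨h1, h2⟩ := hA u hu
    simp only [Set.mem_iUnion]
    exact ⟨round u, round_mem a b u h1, by simpa [sub_eq_add_neg] using h2⟩
  calc volume A ≤ _ := measure_mono hsub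
    _ ≤ ∑ p ∈ Finset.Icc ⌈a - 1/2⌉ ⌊b + 1/2⌋, volume ((fun u : ℝ => u + (-(p : ℝ))) ⁻¹' E) :=
        measure_biUnion_finset_le _ _
    _ = ∑ p ∈ Finset.Icc ⌈a - 1/2⌉ ⌊b + 1/2⌋, volume E := by
        refine Finset.sum_congr rfl fun p _ => ?_
        rw [measure_preimage_add_right]
    _ ≤ ∑ p ∈ Finset.Icc ⌈a - 1/2⌉ ⌊b + 1/2⌋, ENNReal.ofReal C := Finset.sum_le_sum fun _ _ => hE
    _ = ENNReal.ofReal (((Finset.Icc ⌈a - 1/2⌉ ⌊b + 1/2⌋).card : ℝ) * C) := by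
        rw [Finset.sum_const, nsmul_eq_mul, ENNReal.ofReal_mul (by positivity)]
        simp
    _ ≤ _ := ENNReal.ofReal_le_ofReal (mul_le_mul_of_nonneg_right (card_near a b hab) hC)

lemma vol_unit (a b d : ℝ) (hab : a ≤ b) (hd : 0 ≤ d) :
    volume {u : ℝ | u ∈ Set.Icc a b ∧ nint u ≤ d} ≤ ENNReal.ofReal ((b - a + 2) * (2 * d)) := by
  refine vol_cover a b (2 * d) hab (by positivity) _ (Set.Icc (-d) d) ?_ ?_
  · rw [Real.volume_Icc]; apply ENNReal.ofReal_le_ofReal; linarith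
  · rintro u ⟨h1, h2⟩
    exact ⟨h1, abs_le.1 h2⟩

/-- transfer of a bound on an interval under affine change of variables -/
lemma vol_scale (P : ℝ → Prop) (K : ℝ) (hK : 0 ≤ K)
    (H : ∀ a b : ℝ, a ≤ b → volume {u : ℝ | u ∈ Set.Icc a b ∧ P u} ≤ ENNReal.ofReal ((b - a + 2) * K))
    (s c a b : ℝ) (hs : s ≠ 0) (hab : a ≤ b) :
    volume {t : ℝ | t ∈ Set.Icc a b ∧ P (s * t + c)} ≤
      ENNReal.ofReal ((|s| * (b - a) + 2) * (K / |s|)) := by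
  have hs' : 0 < |s| := abs_pos.2 hs
  set a' := min (s * a + c) (s * b + c) with ha'
  set b' := max (s * a + c) (s * b + c) with hb'
  have hab' : b' - a' = |s| * (b - a) := by
    rw [ha', hb', max_sub_min_eq_abs]
    rw [show s * b + c - (s * a + c) = s * (b - a) by ring, abs_mul, abs_of_nonneg (by linarith : 0 ≤ b - a)]
  have hle : a' ≤ b' := min_le_max
  have hsub : {t : ℝ | t ∈ Set.Icc a b ∧ P (s * t + c)} ⊆
      {t : ℝ | s * t + c ∈ {u : ℝ | u ∈ Set.Icc a' b' ∧ P u}} := by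
    rintro t ⟨⟨h1, h2⟩, h3⟩
    refine ⟨⟨?_, ?_⟩, h3⟩
    · rcases lt_or_gt_of_ne hs with h | h
      · exact (min_le_right _ _).trans (by nlinarith)
      · exact (min_le_left _ _).trans (by nlinarith)
    · rcases lt_or_gt_of_ne hs with h | h
      · exact le_trans (by nlinarith) (le_max_left _ _)
      · exact le_trans (by nlinarith) (le_max_right _ _)
  calc _ ≤ _ := measure_mono hsub
    _ = ENNReal.ofReal (|s|⁻¹) * volume {u : ℝ | u ∈ Set.Icc a' b' ∧ P u} := vol_affine s c hs _
    _ ≤ ENNReal.ofReal (|s|⁻¹) * ENNReal.ofReal ((b' - a' + 2) * K) := by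
        gcongr
        exact H a' b' hle
    _ = _ := by
        rw [← ENNReal.ofReal_mul (by positivity), hab']
        congr 1
        field_simp

lemma vol_strip (s c a b d : ℝ) (hs : s ≠ 0) (hab : a ≤ b) (hd : 0 ≤ d) :
    volume {t : ℝ | t ∈ Set.Icc a b ∧ nint (s * t + c) ≤ d} ≤
      ENNReal.ofReal ((|s| * (b - a) + 2) * (2 * d / |s|)) :=
  vol_scale (fun u => nint u ≤ d) (2 * d) (by positivity)
    (fun a b hab => vol_unit a b d hab hd) s c a b hs hab

lemma vol_par_unit (t : ℕ) (ht : 1 ≤ t) (τ d : ℝ) (hτ : 0 < τ) (hd : 0 ≤ d) (hdt : d < t * τ / 2)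
    (a b : ℝ) (hab : a ≤ b) :
    volume {u : ℝ | u ∈ Set.Icc a b ∧ (τ / 2 ≤ nint u ∧ nint u ≤ 3 * τ ∧ nint (t * u) ≤ d)} ≤
      ENNReal.ofReal ((b - a + 2) * (36 * τ * d)) := by
  have ht' : (1 : ℝ) ≤ t := by exact_mod_cast ht
  have key : ∀ u : ℝ, nint (t * u) = nint (t * (u - round u)) := by
    intro u
    rw [← nint_add_int (t * (u - round u)) (t * round u)]
    congr 1
    push_cast
    ring
  rcases lt_or_ge ((t : ℝ) * (3 * τ)) (1 / 2) with h | h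
  · have : {u : ℝ | u ∈ Set.Icc a b ∧ (τ / 2 ≤ nint u ∧ nint u ≤ 3 * τ ∧ nint (t * u) ≤ d)} = ∅ := by
      rw [Set.eq_empty_iff_forall_notMem]
      rintro u ⟨_, h1, h2, h3⟩
      rw [key] at h3
      have e : |(t : ℝ) * (u - round u)| = t * nint u := by
        rw [abs_mul, abs_of_nonneg (by linarith : (0:ℝ) ≤ t)]; rfl
      rw [nint_eq_abs, e] at h3
      · nlinarith
      · rw [e]; nlinarith
    rw [this]; simp
  · refine vol_cover a b _ hab (by positivity) _ {e : ℝ | e ∈ Set.Icc (-(3 * τ)) (3 * τ) ∧ nint (t * e + 0) ≤ d} ?_ ?_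
    · refine (vol_strip t 0 (-(3*τ)) (3*τ) d (by positivity) (by linarith) hd).trans ?_
      apply ENNReal.ofReal_le_ofReal
      rw [abs_of_nonneg (by linarith : (0:ℝ) ≤ t), mul_div_assoc', div_le_iff₀ (by linarith)]
      nlinarith
    · rintro u ⟨h0, h1, h2, h3⟩
      refine ⟨h0, abs_le.1 h2, ?_⟩
      rw [add_zero, ← key]; exact h3

lemma vol_par (t : ℕ) (ht : 1 ≤ t) (τ d : ℝ) (hτ : 0 < τ) (hd : 0 ≤ d) (hdt : d < t * τ / 2)
    (s c a b : ℝ) (hs : s ≠ 0) (hab : a ≤ b) :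
    volume {x : ℝ | x ∈ Set.Icc a b ∧ (τ / 2 ≤ nint (s * x + c) ∧ nint (s * x + c) ≤ 3 * τ ∧
        nint (t * (s * x + c)) ≤ d)} ≤
      ENNReal.ofReal ((|s| * (b - a) + 2) * (36 * τ * d / |s|)) :=
  vol_scale (fun u => τ / 2 ≤ nint u ∧ nint u ≤ 3 * τ ∧ nint (t * u) ≤ d) _ (by positivity)
    (fun a b hab => vol_par_unit t ht τ d hτ hd hdt a b hab) s c a b hs hab

lemma vol_lower_unit (τ a b : ℝ) (hτ : 0 < τ) (hτ' : τ < 1 / 4) :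
    ENNReal.ofReal ((b - a - 2) * τ) ≤
      volume {u : ℝ | u ∈ Set.Ico a b ∧ τ ≤ nint u ∧ nint u ≤ 2 * τ} := by
  set I := Finset.Icc ⌈a⌉ (⌊b⌋ - 1) with hI
  have hcard : b - a - 2 ≤ (I.card : ℝ) := by
    rw [hI, Int.card_Icc]
    have h1 : b - 1 < ⌊b⌋ := Int.sub_one_lt_floor _
    have h2 : (⌈a⌉ : ℝ) < a + 1 := Int.ceil_lt_add_one _
    have h3 : ((⌊b⌋ - 1 + 1 - ⌈a⌉ : ℤ) : ℝ) ≤ (((⌊b⌋ - 1 + 1 - ⌈a⌉).toNat : ℤ) : ℝ) := by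
      exact_mod_cast Int.self_le_toNat _
    push_cast at h3
    simp only [sub_add_cancel] at *
    have h4 : (((⌊b⌋ - ⌈a⌉).toNat : ℤ) : ℝ) = ((⌊b⌋ - ⌈a⌉).toNat : ℝ) := by norm_cast
    push_cast at h4
    linarith
  have hsub : (⋃ p ∈ I, Set.Icc ((p : ℝ) + τ) (p + 2 * τ)) ⊆
      {u : ℝ | u ∈ Set.Ico a b ∧ τ ≤ nint u ∧ nint u ≤ 2 * τ} := by
    intro u hu
    simp only [Set.mem_iUnion] at hu
    obtain ⟨p, hp, h1, h2⟩ := hu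
    rw [hI, Finset.mem_Icc, Int.ceil_le] at hp
    have hp2 : ((p + 1 : ℤ) : ℝ) ≤ b := by
      rw [← Int.le_floor]; linarith [hp.2]
    push_cast at hp2
    have e : nint u = u - p := by
      have : nint u = nint (u - p) := by
        rw [← nint_add_int (u - p) p]; congr 1; ring
      rw [this, nint_eq_abs, abs_of_nonneg (by linarith)]
      rw [abs_of_nonneg (by linarith)]; linarith
    refine ⟨⟨by linarith [hp.1], by linarith⟩, ?_, ?_⟩ <;> rw [e] <;> linarith
  refine le_trans ?_ (measure_mono hsub)
  rw [measure_biUnion_finset]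
  · simp only [Real.volume_Icc]
    have : ∀ p : ℤ, ENNReal.ofReal ((p : ℝ) + 2 * τ - (p + τ)) = ENNReal.ofReal τ := by
      intro p; congr 1; ring
    simp only [this, Finset.sum_const, nsmul_eq_mul]
    rw [← ENNReal.ofReal_natCast, ← ENNReal.ofReal_mul (by positivity)]
    apply ENNReal.ofReal_le_ofReal
    nlinarith
  · intro p _ p' _ hne
    rw [Function.onFun, Set.disjoint_left]
    rintro u ⟨h1, h2⟩ ⟨h3, h4⟩
    apply hne
    have h5 : (p : ℝ) < p' + 1 := by linarith
    have h6 : (p' : ℝ) < p + 1 := by linarith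
    have h5' : p < p' + 1 := by exact_mod_cast h5
    have h6' : p' < p + 1 := by exact_mod_cast h6
    omega
  · intro p _; exact measurableSet_Icc

lemma vol_lower (τ s c a b : ℝ) (hτ : 0 < τ) (hτ' : τ < 1 / 4) (hs : 0 < s) :
    ENNReal.ofReal ((s * (b - a) - 2) * (τ / s)) ≤
      volume {t : ℝ | t ∈ Set.Ico a b ∧ τ ≤ nint (s * t + c) ∧ nint (s * t + c) ≤ 2 * τ} := by
  have e : {t : ℝ | t ∈ Set.Ico a b ∧ τ ≤ nint (s * t + c) ∧ nint (s * t + c) ≤ 2 * τ} =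
     {t : ℝ | s * t + c ∈ {u : ℝ | u ∈ Set.Ico (s * a + c) (s * b + c) ∧ τ ≤ nint u ∧ nint u ≤ 2 * τ}} := by
    ext t
    simp only [Set.mem_setOf_eq, Set.mem_Ico, add_le_add_iff_right, add_lt_add_iff_right,
      mul_le_mul_iff_right₀ hs, mul_lt_mul_iff_right₀ hs]
  rw [e, vol_affine s c hs.ne']
  refine le_trans ?_ (mul_le_mul_right (vol_lower_unit τ (s * a + c) (s * b + c) hτ hτ') _)
  rw [← ENNReal.ofReal_mul (by positivity), abs_of_pos hs]
  apply ENNReal.ofReal_le_ofReal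
  apply le_of_eq
  field_simp
  ring
end MB

namespace MB
open MeasureTheory

lemma vol_le_slices (E : Set (ℝ × ℝ)) (hE : MeasurableSet E) (J : Set ℝ) (hJ : MeasurableSet J)
    (M : ENNReal) (h1 : ∀ z ∈ E, z.2 ∈ J) (h2 : ∀ y ∈ J, volume {x : ℝ | (x, y) ∈ E} ≤ M) :
    volume E ≤ M * volume J := by
  rw [Measure.volume_eq_prod, Measure.prod_apply_symm hE]
  calc _ ≤ ∫⁻ y, J.indicator (fun _ => M) y := by
        apply lintegral_mono
        intro y
        by_cases hy : y ∈ J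
        · simp only [Set.indicator_of_mem hy]; exact h2 y hy
        · have : (fun x : ℝ => (x, y)) ⁻¹' E = ∅ := by
            ext x
            simp only [Set.mem_preimage, Set.mem_empty_iff_false, iff_false]
            exact fun h => hy (h1 _ h)
          simp [this]
    _ = _ := by rw [lintegral_indicator hJ]; simp

lemma vol_ge_slices (E : Set (ℝ × ℝ)) (hE : MeasurableSet E) (J : Set ℝ) (hJ : MeasurableSet J)
    (M : ENNReal) (h2 : ∀ y ∈ J, M ≤ volume {x : ℝ | (x, y) ∈ E}) :
    M * volume J ≤ volume E := by
  rw [Measure.volume_eq_prod, Measure.prod_apply_symm hE]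
  calc _ = ∫⁻ y, J.indicator (fun _ => M) y := by rw [lintegral_indicator hJ]; simp
    _ ≤ _ := by
        apply lintegral_mono
        intro y
        by_cases hy : y ∈ J
        · simp only [Set.indicator_of_mem hy]; exact h2 y hy
        · simp [Set.indicator_of_notMem hy]

lemma vol_shear (E : Set (ℝ × ℝ)) (hE : MeasurableSet E) (r : ℝ) :
    volume E = volume {z : ℝ × ℝ | (z.1, z.2 - r * z.1) ∈ E} := by
  have hm : Measurable (fun z : ℝ × ℝ => (z.1, z.2 - r * z.1)) := by fun_prop
  have hE' : MeasurableSet {z : ℝ × ℝ | (z.1, z.2 - r * z.1) ∈ E} := hm hE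
  rw [Measure.volume_eq_prod, Measure.prod_apply hE, Measure.prod_apply hE']
  congr 1
  ext x
  have : (Prod.mk x ⁻¹' {z : ℝ × ℝ | (z.1, z.2 - r * z.1) ∈ E})
      = (fun y => y + (- (r * x))) ⁻¹' (Prod.mk x ⁻¹' E) := by
    ext y; simp [sub_eq_add_neg]
  rw [this, measure_preimage_add_right]

lemma meas_lin (a b : ℝ) : Measurable (fun z : ℝ × ℝ => nint (a * z.1 + b * z.2)) :=
  measurable_nint.comp (by fun_prop)

/-- closed box -/
def bx (a b l : ℝ) : Set (ℝ × ℝ) := Set.Icc a (a + l) ×ˢ Set.Icc b (b + l)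
/-- half open box -/
def hbx (a b l : ℝ) : Set (ℝ × ℝ) := Set.Ico a (a + l) ×ˢ Set.Ico b (b + l)

lemma meas_bx (a b l : ℝ) : MeasurableSet (bx a b l) := measurableSet_Icc.prod measurableSet_Icc
lemma meas_hbx (a b l : ℝ) : MeasurableSet (hbx a b l) := measurableSet_Ico.prod measurableSet_Ico
lemma hbx_sub (a b l : ℝ) : hbx a b l ⊆ bx a b l :=
  Set.prod_mono Set.Ico_subset_Icc_self Set.Ico_subset_Icc_self

/-- strip -/
def S (v1 v2 d : ℝ) : Set (ℝ × ℝ) := {z | nint (v1 * z.1 + v2 * z.2) ≤ d}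
/-- annular strip -/
def T (v1 v2 d e : ℝ) : Set (ℝ × ℝ) :=
  {z | d ≤ nint (v1 * z.1 + v2 * z.2) ∧ nint (v1 * z.1 + v2 * z.2) ≤ e}

lemma meas_S (v1 v2 d : ℝ) : MeasurableSet (S v1 v2 d) :=
  measurableSet_le (meas_lin v1 v2) measurable_const
lemma meas_T (v1 v2 d e : ℝ) : MeasurableSet (T v1 v2 d e) :=
  (measurableSet_le measurable_const (meas_lin v1 v2)).inter
    (measurableSet_le (meas_lin v1 v2) measurable_const)
lemma T_sub_S (v1 v2 d e : ℝ) : T v1 v2 d e ⊆ S v1 v2 e := fun _ h => h.2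

lemma strip2 (v1 v2 d a b l : ℝ) (hv : v1 ≠ 0) (hd : 0 ≤ d) (hl : 0 ≤ l) :
    volume (bx a b l ∩ S v1 v2 d) ≤ ENNReal.ofReal ((|v1| * l + 2) * (2 * d / |v1|) * l) := by
  have := vol_le_slices (bx a b l ∩ S v1 v2 d) ((meas_bx a b l).inter (meas_S _ _ _))
    (Set.Icc b (b+l)) measurableSet_Icc (ENNReal.ofReal ((|v1| * l + 2) * (2 * d / |v1|)))
    (fun z hz => hz.1.2) (fun y hy => by
      have h := vol_strip v1 (v2 * y) a (a+l) d hv (by linarith) hd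
      rw [add_sub_cancel_left] at h
      refine le_trans (measure_mono ?_) h
      rintro x ⟨hx, hx2⟩
      exact ⟨hx.1, hx2⟩)
  refine this.trans ?_
  rw [Real.volume_Icc, add_sub_cancel_left, ← ENNReal.ofReal_mul (by positivity)]

lemma par2 (t : ℕ) (ht : 1 ≤ t) (τ d v1 v2 a b l : ℝ) (hτ : 0 < τ) (hd : 0 ≤ d)
    (hdt : d < t * τ / 2) (hv : v1 ≠ 0) (hl : 0 ≤ l) :
    volume (bx a b l ∩ T v1 v2 (τ/2) (3*τ) ∩ S (t * v1) (t * v2) d) ≤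
      ENNReal.ofReal ((|v1| * l + 2) * (36 * τ * d / |v1|) * l) := by
  have := vol_le_slices (bx a b l ∩ T v1 v2 (τ/2) (3*τ) ∩ S (t * v1) (t * v2) d)
    (((meas_bx a b l).inter (meas_T _ _ _ _)).inter (meas_S _ _ _))
    (Set.Icc b (b+l)) measurableSet_Icc (ENNReal.ofReal ((|v1| * l + 2) * (36 * τ * d / |v1|)))
    (fun z hz => hz.1.1.2) (fun y hy => by
      have h := vol_par t ht τ d hτ hd hdt v1 (v2 * y) a (a+l) hv (by linarith)
      rw [add_sub_cancel_left] at h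
      refine le_trans (measure_mono ?_) h
      rintro x ⟨⟨hx, hx2⟩, hx3⟩
      refine ⟨hx.1, hx2.1, hx2.2, ?_⟩
      have hx3' : nint (t * v1 * x + t * v2 * y) ≤ d := hx3
      convert hx3' using 2; ring)
  refine this.trans ?_
  rw [Real.volume_Icc, add_sub_cancel_left, ← ENNReal.ofReal_mul (by positivity)]

lemma lower2 (τ v1 v2 a b l : ℝ) (hτ : 0 < τ) (hτ' : τ < 1/4) (hv : 0 < v1) (hl : 0 ≤ l)
    (h2 : 2 ≤ v1 * l) :
    ENNReal.ofReal ((v1 * l - 2) * (τ / v1) * l) ≤ volume (hbx a b l ∩ T v1 v2 τ (2*τ)) := by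
  have := vol_ge_slices (hbx a b l ∩ T v1 v2 τ (2*τ)) ((meas_hbx a b l).inter (meas_T _ _ _ _))
    (Set.Ico b (b+l)) measurableSet_Ico (ENNReal.ofReal ((v1 * l - 2) * (τ / v1)))
    (fun y hy => by
      have h := vol_lower τ v1 (v2 * y) a (a+l) hτ hτ' hv
      rw [add_sub_cancel_left] at h
      refine le_trans h (measure_mono ?_)
      rintro x ⟨hx, hx2⟩
      exact ⟨⟨hx, hy⟩, hx2⟩)
  refine le_trans ?_ this
  have : 0 ≤ v1 * l - 2 := by linarith
  rw [Real.volume_Ico, add_sub_cancel_left, ← ENNReal.ofReal_mul (by positivity)]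

lemma corr2 (h v1 v2 w1 w2 d1 d2 a b l : ℝ) (hh : 0 < h) (hv1 : h ≤ v1) (hv1' : v1 ≤ 2*h)
    (hv2 : h ≤ v2) (hv2' : v2 ≤ 2*h) (hl : 0 < l) (hhl : 1 ≤ h * l) (hd1 : 0 ≤ d1) (hd2 : 0 ≤ d2)
    (hdet : w1 * v2 - w2 * v1 ≠ 0) :
    volume (bx a b l ∩ S v1 v2 d1 ∩ S w1 w2 d2) ≤
      ENNReal.ofReal (20 * d1 * d2 * l * (l + 4 * h / |w1 * v2 - w2 * v1|)) := by
  have hv1p : 0 < v1 := by linarith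
  have hv2p : 0 < v2 := by linarith
  set r := v1 / v2 with hr
  have hr0 : 0 < r := by positivity
  have hr2 : r ≤ 2 := by rw [hr, div_le_iff₀ hv2p]; linarith
  have hrv : r * v2 = v1 := by rw [hr]; field_simp
  set D := w1 - w2 * r with hD
  have hDv : D * v2 = w1 * v2 - w2 * v1 := by rw [hD, sub_mul, mul_assoc, hrv]
  have hD0 : D ≠ 0 := by
    intro h0; apply hdet; rw [← hDv, h0, zero_mul]
  have hE : MeasurableSet (bx a b l ∩ S v1 v2 d1 ∩ S w1 w2 d2) :=
    ((meas_bx a b l).inter (meas_S _ _ _)).inter (meas_S _ _ _)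
  rw [vol_shear _ hE r]
  have hm : Measurable (fun z : ℝ × ℝ => (z.1, z.2 - r * z.1)) := by fun_prop
  set J : Set ℝ := {t | t ∈ Set.Icc (b + r * a) (b + r * a + 3 * l) ∧ nint (v2 * t + 0) ≤ d1} with hJ
  have hJm : MeasurableSet J :=
    measurableSet_Icc.inter (measurableSet_le (measurable_nint.comp (by fun_prop)) measurable_const)
  have h1 := vol_le_slices _ (hm hE) J hJm (ENNReal.ofReal ((|D| * l + 2) * (2 * d2 / |D|))) (by
      rintro ⟨x, y⟩ ⟨⟨⟨⟨hx1, hx2⟩, ⟨hy1, hy2⟩⟩, hz2⟩, hz3⟩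
      simp only at hx1 hx2 hy1 hy2
      refine ⟨⟨?_, ?_⟩, ?_⟩
      · simp only; nlinarith
      · simp only; nlinarith
      · have : nint (v1 * x + v2 * (y - r * x)) ≤ d1 := hz2
        convert this using 2
        simp only
        linear_combination x * hrv)
    (fun y hy => by
      have h := vol_strip D (w2 * y) a (a+l) d2 hD0 (by linarith) hd2
      rw [add_sub_cancel_left] at h
      refine le_trans (measure_mono ?_) h
      rintro x ⟨⟨⟨hx1, _⟩, hz2⟩, hz3⟩
      refine ⟨hx1, ?_⟩
      have : nint (w1 * x + w2 * (y - r * x)) ≤ d2 := hz3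
      convert this using 2
      rw [hD]; ring)
  refine h1.trans ?_
  have h2 := vol_strip v2 0 (b + r * a) (b + r * a + 3 * l) d1 hv2p.ne' (by linarith) hd1
  rw [add_sub_cancel_left] at h2
  refine (mul_le_mul_right h2 _).trans ?_
  rw [← ENNReal.ofReal_mul (by positivity)]
  apply ENNReal.ofReal_le_ofReal
  rw [← hDv, abs_mul, abs_of_pos hv2p]
  have hDp : 0 < |D| := abs_pos.mpr hD0
  have e1 : (|D| * l + 2) * (2 * d2 / |D|) = 2 * d2 * (l + 2 / |D|) := by field_simp
  have e2 : (v2 * (3 * l) + 2) * (2 * d1 / v2) ≤ 10 * d1 * l := by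
    rw [mul_div_assoc', div_le_iff₀ hv2p]
    have : 1 ≤ v2 * l := by nlinarith
    nlinarith
  have e3 : 2 / |D| ≤ 4 * h / (|D| * v2) := by
    rw [div_le_div_iff₀ hDp (by positivity)]
    nlinarith
  rw [e1]
  calc _ ≤ 2 * d2 * (l + 4 * h / (|D| * v2)) * (10 * d1 * l) := by gcongr
    _ = _ := by ring

end MB

namespace MB
open MeasureTheory

/-- harmonic sum -/
noncomputable def Hs (n : ℕ) : ℝ := ∑ i ∈ Finset.Icc 1 n, (1:ℝ) / i

lemma Hs_le (n : ℕ) : Hs n ≤ 1 + Real.log n := by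
  have := harmonic_le_one_add_log n
  rw [harmonic_eq_sum_Icc] at this
  push_cast at this
  simpa [Hs] using this

lemma Hs_nonneg (n : ℕ) : 0 ≤ Hs n := Finset.sum_nonneg fun _ _ => by positivity

/-- the box [h,2h)^2 -/
def V0 (h : ℕ) : Finset (ℕ × ℕ) := Finset.Ico h (2*h) ×ˢ Finset.Ico h (2*h)

lemma mem_V0 {h : ℕ} {v : ℕ × ℕ} : v ∈ V0 h ↔ (h ≤ v.1 ∧ v.1 < 2*h) ∧ (h ≤ v.2 ∧ v.2 < 2*h) := by
  simp [V0]

lemma fiber_count (h w1 w2 : ℕ) (hw1 : 0 < w1) (hc : Nat.Coprime w1 w2) (n : ℤ) :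
    ((V0 h).filter (fun v => (w1:ℤ) * v.2 - w2 * v.1 = n)).card ≤ h / w1 + 1 := by
  rw [← Finset.card_range (h / w1 + 1)]
  apply Finset.card_le_card_of_injOn (fun v => (v.1 - h) / w1)
  · intro v hv
    simp only [Finset.coe_filter, Set.mem_ofPred_eq, mem_V0] at hv
    simp only [Finset.coe_range, Set.mem_Iio]
    exact Nat.lt_succ_of_le (Nat.div_le_div_right (by omega))
  · intro v hv u hu huv
    simp only [Finset.coe_filter, Set.mem_ofPred_eq, mem_V0] at hv hu
    simp only at huv
    have h1 : (w1:ℤ) * (v.2 - u.2) = w2 * (v.1 - u.1) := by linarith [hv.2, hu.2]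
    have h2 : (w1:ℤ) ∣ (v.1 - u.1) := by
      have : (w1:ℤ) ∣ w2 * (v.1 - u.1) := ⟨_, h1.symm⟩
      exact (Nat.isCoprime_iff_coprime.mpr hc).dvd_of_dvd_mul_left this
    have h3 : v.1 = u.1 := by
      have a1 := Nat.div_add_mod (v.1 - h) w1
      have a2 := Nat.div_add_mod (u.1 - h) w1
      have b1 := Nat.mod_lt (v.1 - h) hw1
      have b2 := Nat.mod_lt (u.1 - h) hw1
      rw [huv] at a1
      have : |(v.1:ℤ) - u.1| < w1 := by
        rw [abs_lt]; constructor <;> omega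
      have := Int.eq_zero_of_abs_lt_dvd h2 this
      omega
    have h4 : v.2 = u.2 := by
      rw [h3] at h1
      have : (w1:ℤ) * (v.2 - u.2) = 0 := by rw [h1]; ring
      rcases mul_eq_zero.mp this with h | h <;> omega
    exact Prod.ext h3 h4

lemma det_sum (h M x y : ℕ) (hx : 1 ≤ x) (hy : 1 ≤ y) (hxM : x ≤ M) (hyM : y ≤ M) :
    ∑ v ∈ V0 h, 1 / |(x:ℝ) * v.2 - y * v.1| ≤ 2 * (h / x + 1) * Hs (2 * h * M) := by
  obtain ⟨g, w1, w2, hg, hc, rfl, rfl⟩ : ∃ g w1 w2 : ℕ, 0 < g ∧ Nat.Coprime w1 w2 ∧ x = w1 * g ∧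
      y = w2 * g := by
    have := Nat.exists_coprime x y
    obtain ⟨x', y', hc, h1, h2⟩ := this
    exact ⟨_, x', y', Nat.gcd_pos_of_pos_left _ hx, hc, h1, h2⟩
  have hw1 : 0 < w1 := Nat.pos_of_mul_pos_right hx
  set f : ℕ × ℕ → ℕ := fun v => ((w1:ℤ) * v.2 - w2 * v.1).natAbs with hf
  have e1 : ∀ v : ℕ × ℕ, 1 / |((w1 * g : ℕ):ℝ) * v.2 - (w2 * g : ℕ) * v.1| = 1 / g * (1 / (f v : ℝ)) := by
    intro v
    have : ((f v : ℕ) : ℝ) = |(w1:ℝ) * v.2 - w2 * v.1| := by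
      rw [hf]; simp only [Nat.cast_natAbs]; push_cast; rfl
    rw [this]
    have : ((w1 * g : ℕ):ℝ) * v.2 - (w2 * g : ℕ) * v.1 = g * ((w1:ℝ) * v.2 - w2 * v.1) := by
      push_cast; ring
    rw [this, abs_mul, Nat.abs_cast, one_div_mul_one_div]
  simp_rw [e1]
  rw [← Finset.mul_sum]
  have hle : ∀ v ∈ V0 h, f v ∈ Finset.range (2 * h * M + 1) := by
    intro v hv
    rw [mem_V0] at hv
    rw [Finset.mem_range]
    have a1 : w1 * v.2 ≤ 2 * h * M := by
      calc w1 * v.2 ≤ M * (2*h) := Nat.mul_le_mul (le_trans (Nat.le_mul_of_pos_right _ hg) hxM) (by omega)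
        _ = _ := by ring
    have a2 : w2 * v.1 ≤ 2 * h * M := by
      calc w2 * v.1 ≤ M * (2*h) := Nat.mul_le_mul (le_trans (Nat.le_mul_of_pos_right _ hg) hyM) (by omega)
        _ = _ := by ring
    have : f v = ((↑(w1 * v.2) : ℤ) - ↑(w2 * v.1)).natAbs := by rw [hf]; push_cast; rfl
    rw [this]
    omega
  rw [← Finset.sum_fiberwise_of_maps_to hle]
  have hfib : ∀ N ∈ Finset.range (2 * h * M + 1), ∑ v ∈ (V0 h).filter (fun v => f v = N), 1 / (f v : ℝ)
      ≤ (2 * ((h:ℝ) / w1 + 1)) * (1 / (N:ℝ)) := by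
    intro N _
    have : ∑ v ∈ (V0 h).filter (fun v => f v = N), 1 / (f v : ℝ) =
        ∑ v ∈ (V0 h).filter (fun v => f v = N), 1 / (N : ℝ) := by
      apply Finset.sum_congr rfl
      intro v hv
      rw [(Finset.mem_filter.mp hv).2]
    rw [this, Finset.sum_const, nsmul_eq_mul]
    apply mul_le_mul_of_nonneg_right _ (by positivity)
    have hsub : (V0 h).filter (fun v => f v = N) ⊆
        (V0 h).filter (fun v => (w1:ℤ) * v.2 - w2 * v.1 = N) ∪
        (V0 h).filter (fun v => (w1:ℤ) * v.2 - w2 * v.1 = -N) := by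
      intro v hv
      rw [Finset.mem_filter] at hv
      rw [Finset.mem_union, Finset.mem_filter, Finset.mem_filter]
      have := hv.2
      simp only [hf] at this
      rcases Int.natAbs_eq ((w1:ℤ) * v.2 - w2 * v.1) with h | h
      · left; exact ⟨hv.1, by rw [h, this]⟩
      · right; exact ⟨hv.1, by rw [h, this]⟩
    have c1 := Finset.card_le_card hsub
    have c2 := c1.trans (Finset.card_union_le _ _)
    have c3 := fiber_count h w1 w2 hw1 hc N
    have c4 := fiber_count h w1 w2 hw1 hc (-N)
    have c5 : ((V0 h).filter (fun v => f v = N)).card ≤ 2 * (h / w1 + 1) := by omega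
    calc (((V0 h).filter (fun v => f v = N)).card : ℝ) ≤ ((2 * (h / w1 + 1) : ℕ) : ℝ) := by
          exact_mod_cast c5
      _ = 2 * (((h / w1 : ℕ) : ℝ) + 1) := by push_cast; ring
      _ ≤ _ := by
        have := @Nat.cast_div_le ℝ _ _ _ h w1
        linarith
  have hH : ∑ N ∈ Finset.range (2 * h * M + 1), 1 / (N:ℝ) = Hs (2 * h * M) := by
    rw [Hs, Finset.range_eq_Ico, Finset.sum_eq_sum_Ico_succ_bot (by omega)]
    simp
    rfl
  calc _ ≤ 1 / (g:ℝ) * ∑ N ∈ Finset.range (2 * h * M + 1), (2 * ((h:ℝ) / w1 + 1)) * (1 / (N:ℝ)) := by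
        apply mul_le_mul_of_nonneg_left (Finset.sum_le_sum hfib) (by positivity)
    _ = (2 * (h / (w1 * g) + 1 / g)) * Hs (2 * h * M) := by
        rw [← Finset.mul_sum, hH]
        have : (g:ℝ) ≠ 0 := by positivity
        have : (w1:ℝ) ≠ 0 := by positivity
        field_simp
    _ ≤ _ := by
        apply mul_le_mul_of_nonneg_right _ (Hs_nonneg _)
        have : 1 / (g:ℝ) ≤ 1 := by
          rw [div_le_one (by positivity)]; exact_mod_cast hg
        push_cast
        linarith

lemma det_sum' (h M x y : ℕ) (hx : 1 ≤ x) (hy : 1 ≤ y) (hxM : x ≤ M) (hyM : y ≤ M) :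
    ∑ v ∈ V0 h, 1 / |(x:ℝ) * v.2 - y * v.1| ≤ 2 * (h / y + 1) * Hs (2 * h * M) := by
  have := det_sum h M y x hy hx hyM hxM
  refine le_trans (le_of_eq ?_) this
  apply Finset.sum_nbij' (fun v => (v.2, v.1)) (fun v => (v.2, v.1))
  · intro v hv; rw [mem_V0] at hv ⊢; exact ⟨hv.2, hv.1⟩
  · intro v hv; rw [mem_V0] at hv ⊢; exact ⟨hv.2, hv.1⟩
  · simp
  · simp
  · intro v _
    rw [abs_sub_comm]

/-- coprime pairs -/
def V (h : ℕ) : Finset (ℕ × ℕ) := (V0 h).filter (fun v => Nat.Coprime v.1 v.2)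

lemma card_mult (h d : ℕ) (hd : 0 < d) :
    ((Finset.Ico h (2*h)).filter (fun x => d ∣ x)).card ≤ h / d + 1 := by
  rw [← Finset.card_range (h / d + 1)]
  apply Finset.card_le_card_of_injOn (fun v => (v - h) / d)
  · intro v hv
    simp only [Finset.coe_filter, Set.mem_ofPred_eq, Finset.mem_Ico] at hv
    simp only [Finset.coe_range, Set.mem_Iio]
    exact Nat.lt_succ_of_le (Nat.div_le_div_right (by omega))
  · intro v hv u hu huv
    simp only [Finset.coe_filter, Set.mem_ofPred_eq, Finset.mem_Ico] at hv hu
    simp only at huv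
    have h2 : (d:ℤ) ∣ (v - u) := dvd_sub (by exact_mod_cast hv.2) (by exact_mod_cast hu.2)
    have a1 := Nat.div_add_mod (v - h) d
    have a2 := Nat.div_add_mod (u - h) d
    have b1 := Nat.mod_lt (v - h) hd
    have b2 := Nat.mod_lt (u - h) hd
    rw [huv] at a1
    have : |(v:ℤ) - u| < d := by
      rw [abs_lt]; constructor <;> omega
    have := Int.eq_zero_of_abs_lt_dvd h2 this
    omega

lemma sum_inv_sq (n : ℕ) (hn : 3 ≤ n) :
    (∑ d ∈ Finset.Icc 2 n, (1:ℝ) / ((d:ℕ):ℝ)^2) ≤ (25:ℝ)/36 - 1 / (n:ℝ) := by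
  induction n, hn using Nat.le_induction with
  | base => 
    have : Finset.Icc 2 3 = {2, 3} := by decide
    rw [this, Finset.sum_pair (by norm_num)]; norm_num
  | succ n hn ih =>
    rw [← Finset.insert_Icc_right_eq_Icc_add_one (by omega), Finset.sum_insert (by simp)]
    have h0 : (0:ℝ) < n := by positivity
    have : 1 / ((n+1:ℕ):ℝ)^2 ≤ 1 / n - 1 / ((n+1:ℕ):ℝ) := by
      push_cast
      rw [div_sub_div _ _ h0.ne' (by positivity), div_le_div_iff₀ (by positivity) (by positivity)]
      nlinarith
    linarith

lemma card_V (h : ℕ) (hh : 2 ≤ h) (hbig : 2 * Hs (2*h) + 2 ≤ h / 6) :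
    (h:ℝ)^2 / 8 ≤ (V h).card := by
  have h1 : (V h).card + ((V0 h).filter (fun v => ¬ Nat.Coprime v.1 v.2)).card = (V0 h).card :=
    Finset.card_filter_add_card_filter_not _
  have h2 : (V0 h).card = h * h := by
    rw [V0, Finset.card_product, Nat.card_Ico]; congr 1 <;> omega
  have h3 : (V0 h).filter (fun v => ¬ Nat.Coprime v.1 v.2) ⊆
      (Finset.Icc 2 (2*h)).biUnion (fun d => ((Finset.Ico h (2*h)).filter (fun x => d ∣ x)) ×ˢ
        ((Finset.Ico h (2*h)).filter (fun x => d ∣ x))) := by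
    intro v hv
    rw [Finset.mem_filter, mem_V0] at hv
    simp only [Finset.mem_biUnion, Finset.mem_product, Finset.mem_filter, Finset.mem_Ico,
      Finset.mem_Icc]
    have hp : 0 < Nat.gcd v.1 v.2 := Nat.gcd_pos_of_pos_left _ (by omega)
    have h1 : Nat.gcd v.1 v.2 ≠ 1 := hv.2
    have h2 : Nat.gcd v.1 v.2 ≤ v.1 := Nat.gcd_le_left _ (by omega)
    exact ⟨Nat.gcd v.1 v.2, by omega, ⟨hv.1.1, Nat.gcd_dvd_left _ _⟩, hv.1.2, Nat.gcd_dvd_right _ _⟩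
  have h4 : (((V0 h).filter (fun v => ¬ Nat.Coprime v.1 v.2)).card : ℝ) ≤
      ∑ d ∈ Finset.Icc 2 (2*h), ((h:ℝ)/d + 1)^2 := by
    have := (Finset.card_le_card h3).trans Finset.card_biUnion_le
    refine le_trans (Nat.cast_le.mpr this) ?_
    rw [Nat.cast_sum]
    apply Finset.sum_le_sum
    intro d hd
    rw [Finset.mem_Icc] at hd
    rw [Finset.card_product, Nat.cast_mul, ← sq]
    have := card_mult h d (by omega)
    have h5 : (((Finset.Ico h (2*h)).filter (fun x => d ∣ x)).card : ℝ) ≤ (h:ℝ)/d + 1 := by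
      refine le_trans (Nat.cast_le.mpr this) ?_
      have := @Nat.cast_div_le ℝ _ _ _ h d
      push_cast
      linarith
    gcongr
  have h5 : ∑ d ∈ Finset.Icc 2 (2*h), ((h:ℝ)/d + 1)^2 ≤ (h:ℝ)^2 * (25/36) + 2 * h * Hs (2*h) + 2 * h := by
    have e : ∀ d ∈ Finset.Icc 2 (2*h), ((h:ℝ)/d + 1)^2 = (h:ℝ)^2 * (1 / (d:ℝ)^2) + 2 * h * (1 / d) + 1 := by
      intro d hd
      rw [Finset.mem_Icc] at hd
      have : (d:ℝ) ≠ 0 := by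
        have : d ≠ 0 := by omega
        exact_mod_cast this
      field_simp
      ring
    rw [Finset.sum_congr rfl e, Finset.sum_add_distrib, Finset.sum_add_distrib, ← Finset.mul_sum,
      ← Finset.mul_sum]
    have a1 := sum_inv_sq (2*h) (by omega)
    have a2 : ∑ d ∈ Finset.Icc 2 (2*h), 1 / (d:ℝ) ≤ Hs (2*h) := by
      apply Finset.sum_le_sum_of_subset_of_nonneg
      · exact Finset.Icc_subset_Icc_left (by omega)
      · intros; positivity
    have a3 : ∑ d ∈ Finset.Icc 2 (2*h), (1:ℝ) ≤ 2 * h := by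
      rw [Finset.sum_const, Nat.card_Icc, nsmul_eq_mul, mul_one]
      have : 2 * h + 1 - 2 ≤ 2 * h := by omega
      exact_mod_cast this
    have a4 : (0:ℝ) ≤ 1 / ((2*h : ℕ):ℝ) := by positivity
    have a5 : ∑ d ∈ Finset.Icc 2 (2*h), 1 / (d:ℝ)^2 ≤ 25/36 := by linarith
    gcongr
  have h6 : ((V h).card : ℝ) + ((V0 h).filter (fun v => ¬ Nat.Coprime v.1 v.2)).card = h * h := by
    rw [h2] at h1; exact_mod_cast h1
  have h7 : (0:ℝ) ≤ h := by positivity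
  nlinarith [mul_le_mul_of_nonneg_left hbig h7]

end MB

namespace MB
open MeasureTheory

lemma big_pow (m : ℕ) (hm : 40 ≤ m) : 40000000 * m^2 ≤ 2^m := by
  induction m, hm using Nat.le_induction with
  | base => norm_num
  | succ n hn ih =>
    rw [pow_succ 2 n]
    nlinarith

lemma big_pow' (m : ℕ) (hm : 40 ≤ m) : 40000000 * (m:ℝ)^2 ≤ 2^m := by
  exact_mod_cast big_pow m hm

lemma Hs_big (m : ℕ) (hm : 1 ≤ m) : Hs (2 * 2^(7*m) * 2^(48*m)) ≤ 56 * m := by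
  refine (Hs_le _).trans ?_
  have : ((2 * 2^(7*m) * 2^(48*m) : ℕ) : ℝ) = 2^(55*m+1) := by push_cast; ring
  rw [this, Real.log_pow]
  have h1 := Real.log_two_lt_d9
  have h0 : 0 < Real.log 2 := Real.log_pos (by norm_num)
  have : (1:ℝ) ≤ m := by exact_mod_cast hm
  push_cast
  nlinarith

lemma Hs_mono {a b : ℕ} (h : a ≤ b) : Hs a ≤ Hs b := by
  apply Finset.sum_le_sum_of_subset_of_nonneg
  · exact Finset.Icc_subset_Icc_right h
  · intros; positivity

lemma Hs_two (n : ℕ) (hn : 2 ≤ n) : Hs (2^(2*n)) ≤ 2 * n := by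
  refine (Hs_le _).trans ?_
  have : ((2^(2*n) : ℕ) : ℝ) = 2^(2*n) := by push_cast; ring
  rw [this, Real.log_pow]
  have h1 := Real.log_two_lt_d9
  have h0 : 0 < Real.log 2 := Real.log_pos (by norm_num)
  have : (2:ℝ) ≤ n := by exact_mod_cast hn
  push_cast
  nlinarith

/-- threshold at level n -/
noncomputable def dl (n : ℕ) (v : ℕ × ℕ) : ℝ := 1 / 10000000 / (v.1 * v.2 * (n:ℝ)^2)

lemma dl_nonneg (n : ℕ) (v : ℕ × ℕ) : 0 ≤ dl n v := by unfold dl; positivity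

/-- box of admissible vectors -/
def bigbox (N : ℕ) : Finset (ℕ × ℕ) := Finset.Icc 1 N ×ˢ Finset.Icc 1 N

lemma dl_sum (n : ℕ) (hn : 2 ≤ n) (B : Finset (ℕ × ℕ)) (hB : B ⊆ bigbox (2^(2*n))) :
    ∑ v ∈ B, dl n v ≤ 4 / 10000000 := by
  calc ∑ v ∈ B, dl n v ≤ ∑ v ∈ bigbox (2^(2*n)), dl n v :=
        Finset.sum_le_sum_of_subset_of_nonneg hB fun v _ _ => dl_nonneg n v
    _ = 1 / 10000000 / (n:ℝ)^2 * (Hs (2^(2*n)) * Hs (2^(2*n))) := by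
        rw [bigbox, Finset.sum_product, Hs, Finset.sum_mul_sum, Finset.mul_sum]
        apply Finset.sum_congr rfl
        intro x _
        rw [Finset.mul_sum]
        apply Finset.sum_congr rfl
        intro y _
        simp only [dl, mul_inv, div_eq_mul_inv]
        ring
    _ ≤ 1 / 10000000 / (n:ℝ)^2 * ((2*n) * (2*n)) := by
        have := Hs_two n hn
        have := Hs_nonneg (2^(2*n))
        gcongr
    _ = _ := by
        have : (n:ℝ) ≠ 0 := by positivity
        field_simp; norm_num

/-- target width -/
noncomputable def tau (m : ℕ) : ℝ := 1 / (((2:ℝ)^(7*m))^2 * (24*m:ℝ)^2)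

lemma tau_pos (m : ℕ) (hm : 1 ≤ m) : 0 < tau m := by
  have : (0:ℝ) < m := by exact_mod_cast hm
  unfold tau; positivity

/-- next block of vectors -/
def block (m : ℕ) : Finset (ℕ × ℕ) := (bigbox (2^(48*m))).filter (fun v => 2^(2*m) < max v.1 v.2)

lemma real_le_of {A : Set (ℝ × ℝ)} {r : ℝ} (hr : 0 ≤ r) (h : volume A ≤ ENNReal.ofReal r) :
    volume.real A ≤ r := ENNReal.toReal_le_of_le_ofReal hr h

lemma vol_hbx_ne_top (a b l : ℝ) : volume (hbx a b l) ≠ ⊤ := by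
  rw [hbx, Measure.volume_eq_prod, Measure.prod_prod, Real.volume_Ico, Real.volume_Ico]
  exact ENNReal.mul_ne_top ENNReal.ofReal_ne_top ENNReal.ofReal_ne_top

/-- restricted measure -/
noncomputable def muQ (a b l : ℝ) : Measure (ℝ × ℝ) := volume.restrict (hbx a b l)

instance (a b l : ℝ) : IsFiniteMeasure (muQ a b l) :=
  ⟨by rw [muQ, Measure.restrict_apply_univ]; exact (vol_hbx_ne_top a b l).lt_top⟩

lemma muQ_real (a b l : ℝ) {E : Set (ℝ × ℝ)} (hE : MeasurableSet E) :
    (muQ a b l).real E = volume.real (hbx a b l ∩ E) := by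
  rw [muQ, measureReal_restrict_apply hE, Set.inter_comm]


lemma ell_h (m : ℕ) (hm : 40 ≤ m) : (4:ℝ) ≤ 2^(7*m) * (1/2)^m := by
  have : (2:ℝ)^(7*m) * (1/2)^m = 2^(6*m) := by
    rw [show 7*m = 6*m+m by ring, pow_add, mul_assoc, ← mul_pow]; norm_num
  rw [this]
  calc (4:ℝ) = 2^2 := by norm_num
    _ ≤ _ := pow_le_pow_right₀ (by norm_num) (by omega)

lemma tau_small (m : ℕ) (hm : 40 ≤ m) : tau m < 1/4 := by
  have h1 : (1:ℝ) ≤ 2^(7*m) := one_le_pow₀ (by norm_num)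
  have h2 : (40:ℝ) ≤ m := by exact_mod_cast hm
  unfold tau
  rw [div_lt_div_iff₀ (by positivity) (by norm_num)]
  have : (1:ℝ) ≤ (2^(7*m))^2 := one_le_pow₀ h1
  nlinarith

lemma L1 (m : ℕ) (hm : 40 ≤ m) (a b : ℝ) (v : ℕ × ℕ) (hv : v ∈ V0 (2^(7*m))) :
    tau m * (1/4)^m / 2 ≤ (muQ a b ((1/2)^m)).real (T v.1 v.2 (tau m) (2 * tau m)) := by
  rw [muQ_real _ _ _ (meas_T _ _ _ _)]
  rw [mem_V0] at hv
  have hv1 : (2:ℝ)^(7*m) ≤ v.1 := by exact_mod_cast hv.1.1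
  have hl : (0:ℝ) < (1/2)^m := by positivity
  have h4 : (4:ℝ) ≤ v.1 * (1/2)^m := (ell_h m hm).trans (by gcongr)
  have hv0 : (0:ℝ) < v.1 := lt_of_lt_of_le (by positivity) hv1
  have ht := tau_pos m (by omega)
  have h := lower2 (tau m) v.1 v.2 a b ((1/2)^m) ht (tau_small m hm) hv0 hl.le (by linarith)
  have hfin : volume (hbx a b ((1/2)^m) ∩ T v.1 v.2 (tau m) (2 * tau m)) ≠ ⊤ :=
    measure_ne_top_of_subset Set.inter_subset_left (vol_hbx_ne_top _ _ _)
  have h2 := (ENNReal.ofReal_le_iff_le_toReal hfin).mp h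
  refine le_trans ?_ h2
  have e : ((1:ℝ)/4)^m = (1/2)^m * (1/2)^m := by rw [← mul_pow]; norm_num
  rw [e]
  set l : ℝ := (1/2)^m
  have : tau m * l / 2 ≤ (v.1 * l - 2) * (tau m / v.1) := by
    rw [mul_div_assoc', div_le_div_iff₀ (by norm_num) hv0]
    nlinarith
  nlinarith

lemma corrQ (m : ℕ) (hm : 40 ≤ m) (a b : ℝ) (v w : ℕ × ℕ) (hv : v ∈ V0 (2^(7*m))) (d1 d2 : ℝ) (hd1 : 0 ≤ d1) (hd2 : 0 ≤ d2)
    (hdet : (w.1:ℝ) * v.2 - w.2 * v.1 ≠ 0) {E : Set (ℝ × ℝ)} (hE : MeasurableSet E)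
    (hEs : E ⊆ S v.1 v.2 d1 ∩ S w.1 w.2 d2) :
    (muQ a b ((1/2)^m)).real E ≤ 20 * d1 * d2 * (1/2)^m * ((1/2)^m +
      4 * 2^(7*m) * (1 / |(w.1:ℝ) * v.2 - w.2 * v.1|)) := by
  rw [muQ_real _ _ _ hE]
  rw [mem_V0] at hv
  have hv1 : (2:ℝ)^(7*m) ≤ v.1 := by exact_mod_cast hv.1.1
  have hv2 : (2:ℝ)^(7*m) ≤ v.2 := by exact_mod_cast hv.2.1
  have hv1' : (v.1:ℝ) ≤ 2 * 2^(7*m) := by exact_mod_cast hv.1.2.le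
  have hv2' : (v.2:ℝ) ≤ 2 * 2^(7*m) := by exact_mod_cast hv.2.2.le
  have h := corr2 (2^(7*m)) v.1 v.2 w.1 w.2 d1 d2 a b ((1/2)^m) (by positivity) hv1 hv1' hv2 hv2'
    (by positivity) (by linarith [ell_h m hm]) hd1 hd2 hdet
  rw [mul_one_div]
  apply real_le_of (by positivity)
  refine le_trans (measure_mono ?_) h
  intro z hz
  exact ⟨⟨hbx_sub _ _ _ hz.1, (hEs hz.2).1⟩, (hEs hz.2).2⟩

lemma H_ell (m : ℕ) (hm : 40 ≤ m) : 8 * (1/2:ℝ)^m * Hs (2 * 2^(7*m) * 2^(48*m)) ≤ 1 / 16 := by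
  have h1 := Hs_big m (by omega)
  have h2 := big_pow' m hm
  have h3 : (40:ℝ) ≤ m := by exact_mod_cast hm
  have h4 : (1/2:ℝ)^m * 2^m = 1 := by rw [← mul_pow]; norm_num
  have h5 : (0:ℝ) < (1/2)^m := by positivity
  calc 8 * (1/2:ℝ)^m * Hs (2 * 2^(7*m) * 2^(48*m)) ≤ 8 * (1/2:ℝ)^m * (56 * m) := by gcongr
    _ ≤ 1/16 := by nlinarith

lemma card_V' (m : ℕ) (hm : 40 ≤ m) : ((2:ℝ)^(7*m))^2 / 8 ≤ (V (2^(7*m))).card := by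
  have h := card_V (2^(7*m)) (by
    calc 2 = 2^1 := by norm_num
      _ ≤ _ := Nat.pow_le_pow_right (by norm_num) (by omega)) (by
    have h1 := Hs_big m (by omega)
    have h2 : Hs (2 * 2^(7*m)) ≤ Hs (2 * 2^(7*m) * 2^(48*m)) :=
      Hs_mono (Nat.le_mul_of_pos_right _ (by positivity))
    have h3 := big_pow' m hm
    have h4 : (2:ℝ)^m ≤ 2^(7*m) := pow_le_pow_right₀ (by norm_num) (by omega)
    have h5 : (40:ℝ) ≤ m := by exact_mod_cast hm
    push_cast
    nlinarith)
  push_cast at h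
  exact h

lemma det_ne (m : ℕ) (hm : 40 ≤ m) {h : ℕ} (hh : 0 < h) {v w : ℕ × ℕ} (hv : v ∈ V h) (hw : w ∈ V h) (hne : v ≠ w) :
    (w.1:ℝ) * v.2 - w.2 * v.1 ≠ 0 := by
  intro h0
  apply hne
  rw [V, Finset.mem_filter, mem_V0] at hv hw
  have h1 : w.1 * v.2 = w.2 * v.1 := by
    have : (w.1:ℝ) * v.2 = w.2 * v.1 := by linarith
    exact_mod_cast this
  have a1 : v.1 ∣ w.1 := hv.2.dvd_of_dvd_mul_right ⟨w.2, by linarith⟩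
  have a2 : w.1 ∣ v.1 := hw.2.dvd_of_dvd_mul_left ⟨v.2, by linarith⟩
  have e1 : v.1 = w.1 := Nat.dvd_antisymm a1 a2
  have e2 : v.2 = w.2 := by
    rw [e1, mul_comm w.2] at h1
    exact Nat.eq_of_mul_eq_mul_left (by omega) h1
  exact Prod.ext e1 e2

lemma L2 (m : ℕ) (hm : 40 ≤ m) (a b : ℝ) : ∑ w ∈ V (2^(7*m)), ∑ v ∈ (V (2^(7*m))).erase w,
    (muQ a b ((1/2)^m)).real (T v.1 v.2 (tau m) (2 * tau m) ∩ T w.1 w.2 (tau m) (2 * tau m))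
    ≤ (V (2^(7*m))).card * (tau m * (1/4)^m / 16) := by
  have ht := tau_pos m (by omega)
  set h : ℕ := 2^(7*m) with hh
  have hpos : 0 < h := by positivity
  have hcast : (h:ℝ) = 2^(7*m) := by rw [hh]; push_cast; rfl
  rw [← nsmul_eq_mul]
  apply Finset.sum_le_card_nsmul
  intro w hw
  have hw' := hw
  rw [V, Finset.mem_filter, mem_V0] at hw'
  have hMh : 2 * h ≤ 2^(48*m) := by
    rw [hh]
    calc 2 * 2^(7*m) = 2^(7*m+1) := by ring
      _ ≤ _ := Nat.pow_le_pow_right (by norm_num) (by omega)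
  have hds := det_sum h (2^(48*m)) w.1 w.2 (by omega) (by omega) (by omega) (by omega)
  have hHe := H_ell m hm
  rw [← hh] at hHe
  have hH0 := Hs_nonneg (2 * h * 2^(48*m))
  set H := Hs (2 * h * 2^(48*m))
  have hx1 : (h:ℝ) / w.1 ≤ 1 := by
    rw [div_le_one (by exact_mod_cast (by omega : 0 < w.1))]
    exact_mod_cast hw'.1.1.1
  have hds2 : ∑ v ∈ V0 h, 1 / |(w.1:ℝ) * v.2 - w.2 * v.1| ≤ 4 * H := by nlinarith
  calc _ ≤ ∑ v ∈ (V h).erase w, (20 * (2 * tau m) * (2 * tau m) * (1/2)^m * ((1/2)^m +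
      4 * 2^(7*m) * (1 / |(w.1:ℝ) * v.2 - w.2 * v.1|))) := by
        apply Finset.sum_le_sum
        intro v hv
        rw [Finset.mem_erase] at hv
        apply corrQ m hm a b v w (Finset.mem_filter.mp hv.2).1 (2 * tau m) (2 * tau m) (by positivity)
          (by positivity) (det_ne m hm hpos hv.2 hw hv.1) ((meas_T _ _ _ _).inter (meas_T _ _ _ _))
        exact Set.inter_subset_inter (T_sub_S _ _ _ _) (T_sub_S _ _ _ _)
    _ ≤ ∑ v ∈ V0 h, (20 * (2 * tau m) * (2 * tau m) * (1/2)^m * ((1/2)^m +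
      4 * 2^(7*m) * (1 / |(w.1:ℝ) * v.2 - w.2 * v.1|))) := by
        apply Finset.sum_le_sum_of_subset_of_nonneg
        · exact (Finset.erase_subset _ _).trans (Finset.filter_subset _ _)
        · intros; positivity
    _ = 80 * tau m ^2 * (1/2)^m * (h * h * (1/2)^m + 4 * h * ∑ v ∈ V0 h, 1 / |(w.1:ℝ) * v.2 - w.2 * v.1|) := by
        rw [← Finset.mul_sum, Finset.sum_add_distrib, ← Finset.mul_sum, Finset.sum_const]
        have h2 : (V0 h).card = h * h := by
          rw [V0, Finset.card_product, Nat.card_Ico]; congr 1 <;> omega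
        rw [h2, nsmul_eq_mul, ← hcast]
        push_cast
        ring
    _ ≤ 80 * tau m ^2 * (1/2)^m * (h * h * (1/2)^m + 4 * h * (4 * H)) := by gcongr
    _ ≤ 80 * tau m ^2 * (1/2)^m * (h * h * (1/2)^m + h * h * (1/2)^m) := by
        have hl4 : H ≤ 1 / 128 * 2^m := by
          have h4 : (1/2:ℝ)^m * 2^m = 1 := by rw [← mul_pow]; norm_num
          have : 0 < (2:ℝ)^m := by positivity
          nlinarith
        have hl5 : (2:ℝ)^m ≤ h * (1/2)^m := by
          rw [hcast, show 7*m = 6*m+m by ring, pow_add, mul_assoc, ← mul_pow]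
          norm_num
          exact pow_le_pow_right₀ (by norm_num) (by omega)
        have : 4 * (4 * H) ≤ h * (1/2)^m := by
          have : 0 < (2:ℝ)^m := by positivity
          linarith
        have : (4:ℝ) * h * (4 * H) ≤ h * h * (1/2)^m := by
          have : (0:ℝ) ≤ h := by positivity
          nlinarith
        gcongr
    _ = 160 * (tau m * (h^2)) * (tau m * (1/4)^m) := by
        have e : ((1:ℝ)/4)^m = (1/2)^m * (1/2)^m := by rw [← mul_pow]; norm_num
        rw [e]; ring
    _ ≤ _ := by
        have h5 : (40:ℝ) ≤ m := by exact_mod_cast hm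
        have e : tau m * (h^2) = 1 / (24*m)^2 := by
          rw [tau, hcast]; field_simp
        have e2 : tau m * (h^2) ≤ 1 / 2560 := by
          rw [e]
          apply one_div_le_one_div_of_le (by norm_num)
          nlinarith
        have : 0 < tau m * (1/4:ℝ)^m := by positivity
        nlinarith
end MB

namespace MB
open MeasureTheory


lemma pairQ (m : ℕ) (hm : 40 ≤ m) (a b : ℝ) (v w : ℕ × ℕ) (hv : v ∈ V (2^(7*m))) (hw : w ∈ block m) :
    (muQ a b ((1/2)^m)).real (T v.1 v.2 (tau m / 2) (3 * tau m) ∩ S w.1 w.2 (2 * dl (24*m) w)) ≤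
      tau m * dl (24*m) w * (216 * (1/4)^m + 480 * (1/2)^m * 2^(7*m) *
        (1 / |(w.1:ℝ) * v.2 - w.2 * v.1|)) := by
  have ht := tau_pos m (by omega)
  have hd := dl_nonneg (24*m) w
  have hv' := hv
  rw [V, Finset.mem_filter] at hv'
  have e : ((1:ℝ)/4)^m = (1/2)^m * (1/2)^m := by rw [← mul_pow]; norm_num
  by_cases hdet : (w.1:ℝ) * v.2 - w.2 * v.1 = 0
  · rw [hdet, abs_zero, div_zero, mul_zero, add_zero]
    rw [muQ_real _ _ _ ((meas_T _ _ _ _).inter (meas_S _ _ _))]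
    have hvb := hv'.1
    rw [mem_V0] at hvb
    have hw' := hw
    simp only [block, bigbox, Finset.mem_filter, Finset.mem_product, Finset.mem_Icc] at hw'
    have hnat : w.1 * v.2 = w.2 * v.1 := by
      have : (w.1:ℝ) * v.2 = w.2 * v.1 := by linarith
      exact_mod_cast this
    have hv1 : (2:ℝ)^(7*m) ≤ v.1 := by exact_mod_cast hvb.1.1
    have hv2 : (2:ℝ)^(7*m) ≤ v.2 := by exact_mod_cast hvb.2.1
    have hv0 : (0:ℝ) < v.1 := lt_of_lt_of_le (by positivity) hv1
    have hv02 : (0:ℝ) < v.2 := lt_of_lt_of_le (by positivity) hv2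
    obtain ⟨t, ht1⟩ : v.1 ∣ w.1 := hv'.2.dvd_of_dvd_mul_right ⟨w.2, by linarith⟩
    have ht2 : w.2 = v.2 * t := by
      rw [ht1] at hnat
      have h0 : 0 < v.1 := by exact_mod_cast hv0
      apply Nat.eq_of_mul_eq_mul_left h0
      linarith
    have ht0 : 1 ≤ t := by
      rcases Nat.eq_zero_or_pos t with h | h
      · rw [h] at ht1; omega
      · exact h
    have htr : (1:ℝ) ≤ t := by exact_mod_cast ht0
    have hw1 : (w.1:ℝ) = t * v.1 := by rw [ht1]; push_cast; ring
    have hw2 : (w.2:ℝ) = t * v.2 := by rw [ht2]; push_cast; ring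
    have hmr : (40:ℝ) ≤ m := by exact_mod_cast hm
    have hdt : dl (24*m) w ≤ 1 / 10000000 * tau m := by
      rw [dl, tau, hw1, hw2, div_eq_mul_one_div]
      apply mul_le_mul_of_nonneg_left _ (by norm_num)
      apply one_div_le_one_div_of_le (by positivity)
      push_cast
      rw [sq ((2:ℝ)^(7*m))]
      gcongr
      · nlinarith
      · nlinarith
    have h := par2 t ht0 (tau m) (2 * dl (24*m) w) v.1 v.2 a b ((1/2)^m) ht (by positivity)
      (by nlinarith) hv0.ne' (by positivity)
    rw [abs_of_pos hv0] at h
    have h2 : volume.real (hbx a b ((1/2)^m) ∩ (T v.1 v.2 (tau m / 2) (3 * tau m) ∩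
        S w.1 w.2 (2 * dl (24*m) w))) ≤ (v.1 * (1/2)^m + 2) * (36 * tau m * (2 * dl (24*m) w) / v.1)
          * (1/2)^m := by
      apply real_le_of (by positivity)
      refine le_trans (measure_mono ?_) h
      rw [hw1, hw2]
      intro z hz
      exact ⟨⟨hbx_sub _ _ _ hz.1, hz.2.1⟩, hz.2.2⟩
    refine h2.trans ?_
    have h4 : (4:ℝ) ≤ v.1 * (1/2)^m := (ell_h m hm).trans (by gcongr)
    have h5 : (v.1 * (1/2:ℝ)^m + 2) ≤ 3 * v.1 * (1/2)^m := by linarith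
    calc _ ≤ (3 * v.1 * (1/2)^m) * (36 * tau m * (2 * dl (24*m) w) / v.1) * (1/2)^m := by gcongr
      _ = _ := by rw [e]; field_simp; ring
  · have h := corrQ m hm a b v w hv'.1 (3 * tau m) (2 * dl (24*m) w) (by positivity) (by positivity)
      hdet ((meas_T v.1 v.2 (tau m / 2) (3 * tau m)).inter (meas_S w.1 w.2 (2 * dl (24*m) w)))
      (Set.inter_subset_inter_left _ (T_sub_S _ _ _ _))
    refine h.trans ?_
    rw [e]
    have : 0 ≤ tau m * dl (24*m) w * ((1/2)^m * (1/2)^m) := by positivity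
    nlinarith

lemma L3 (m : ℕ) (hm : 40 ≤ m) (a b : ℝ) : ∑ v ∈ V (2^(7*m)), ∑ w ∈ block m,
    (muQ a b ((1/2)^m)).real (T v.1 v.2 (tau m / 2) (3 * tau m) ∩ S w.1 w.2 (2 * dl (24*m) w))
    ≤ (V (2^(7*m))).card * (tau m * (1/4)^m / 768) := by
  have ht := tau_pos m (by omega)
  set h : ℕ := 2^(7*m) with hh
  have hpos : 0 < h := by positivity
  have hcast : (h:ℝ) = 2^(7*m) := by rw [hh]; push_cast; rfl
  have e : ((1:ℝ)/4)^m = (1/2)^m * (1/2)^m := by rw [← mul_pow]; norm_num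
  rw [Finset.sum_comm]
  have hcard := card_V' m hm
  rw [← hh, ← hcast] at hcard
  have hHe := H_ell m hm
  rw [← hh] at hHe
  have hH0 := Hs_nonneg (2 * h * 2^(48*m))
  set H := Hs (2 * h * 2^(48*m)) with hHdef
  have key : ∀ w ∈ block m, ∑ v ∈ V h, (muQ a b ((1/2)^m)).real
      (T v.1 v.2 (tau m / 2) (3 * tau m) ∩ S w.1 w.2 (2 * dl (24*m) w)) ≤
      dl (24*m) w * ((V h).card * (tau m * (1/4)^m * 1000)) := by
    intro w hw
    have hw' := hw
    simp only [block, bigbox, Finset.mem_filter, Finset.mem_product, Finset.mem_Icc] at hw'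
    have hd := dl_nonneg (24*m) w
    have hds : ∑ v ∈ V0 h, 1 / |(w.1:ℝ) * v.2 - w.2 * v.1| ≤ 4 * (h * (1/4)^m) * H := by
      have aux : ∀ x : ℕ, 2^(2*m) < x → (h:ℝ) / x + 1 ≤ 2 * (h * (1/4)^m) := by
        intro x hx
        have hx' : (2:ℝ)^(2*m) ≤ x := by exact_mod_cast hx.le
        have h1 : (h:ℝ) / x ≤ h * (1/4)^m := by
          have : (2:ℝ)^(2*m) = 4^m := by rw [pow_mul]; norm_num
          rw [this] at hx'
          rw [div_eq_mul_one_div, one_div_pow]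
          gcongr
        have h2 : (1:ℝ) ≤ h * (1/4)^m := by
          rw [hcast, one_div_pow, mul_one_div, le_div_iff₀ (by positivity), one_mul,
            show (4:ℝ) = 2^2 by norm_num, ← pow_mul]
          exact pow_le_pow_right₀ (by norm_num) (by omega)
        linarith
      rcases lt_max_iff.mp hw'.2 with hx | hy
      · have := det_sum h (2^(48*m)) w.1 w.2 (by omega) (by omega) (by omega) (by omega)
        have h3 := aux _ hx
        rw [← hHdef] at this
        nlinarith
      · have := det_sum' h (2^(48*m)) w.1 w.2 (by omega) (by omega) (by omega) (by omega)
        have h3 := aux _ hy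
        rw [← hHdef] at this
        nlinarith
    calc _ ≤ ∑ v ∈ V h, tau m * dl (24*m) w * (216 * (1/4)^m + 480 * (1/2)^m * 2^(7*m) *
        (1 / |(w.1:ℝ) * v.2 - w.2 * v.1|)) := by
          apply Finset.sum_le_sum
          intro v hv
          exact pairQ m hm a b v w hv hw
      _ = tau m * dl (24*m) w * ((V h).card * (216 * (1/4)^m) + 480 * (1/2)^m * h *
          ∑ v ∈ V h, (1 / |(w.1:ℝ) * v.2 - w.2 * v.1|)) := by
          rw [← Finset.mul_sum, Finset.sum_add_distrib, ← Finset.mul_sum, Finset.sum_const,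
            nsmul_eq_mul, hcast, ← Finset.mul_sum]
          ring
      _ ≤ tau m * dl (24*m) w * ((V h).card * (216 * (1/4)^m) + 480 * (1/2)^m * h *
          (4 * (h * (1/4)^m) * H)) := by
          have : ∑ v ∈ V h, (1 / |(w.1:ℝ) * v.2 - w.2 * v.1|) ≤ 4 * (h * (1/4)^m) * H := by
            refine le_trans (Finset.sum_le_sum_of_subset_of_nonneg (Finset.filter_subset _ _) ?_) hds
            intros; positivity
          gcongr
      _ = tau m * dl (24*m) w * (1/4)^m * ((V h).card * 216 + 240 * (h^2) * (8 * (1/2)^m * H)) := by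
          ring
      _ ≤ tau m * dl (24*m) w * (1/4)^m * ((V h).card * 216 + 240 * (8 * (V h).card) * (1/16)) := by
          have : (h:ℝ)^2 ≤ 8 * (V h).card := by linarith
          gcongr
      _ ≤ tau m * dl (24*m) w * (1/4)^m * ((V h).card * 1000) := by
          have : (0:ℝ) ≤ (V h).card := by positivity
          gcongr
          linarith
      _ = _ := by ring
  refine (Finset.sum_le_sum key).trans ?_
  rw [← Finset.sum_mul]
  have hs := dl_sum (24*m) (by omega) (block m) (by
    rw [block, show 2 * (24*m) = 48*m by ring]; exact Finset.filter_subset _ _)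
  calc _ ≤ 4 / 10000000 * (((V h).card:ℝ) * (tau m * (1/4)^m * 1000)) := by gcongr
    _ ≤ _ := by
      have : 0 ≤ ((V h).card:ℝ) * (tau m * (1/4)^m) := by positivity
      nlinarith

lemma L4 (m : ℕ) (hm : 40 ≤ m) (a b : ℝ) (v : ℕ × ℕ) (hv : v ∈ V0 (2^(7*m))) :
    volume.real (hbx a b ((1/2)^(7*m)) ∩ T v.1 v.2 (tau m) (2 * tau m)) ≤
      12 * tau m * (1/4)^(7*m) := by
  have ht := tau_pos m (by omega)
  rw [mem_V0] at hv
  have hv1 : (2:ℝ)^(7*m) ≤ v.1 := by exact_mod_cast hv.1.1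
  have hv0 : (0:ℝ) < v.1 := lt_of_lt_of_le (by positivity) hv1
  have h := strip2 v.1 v.2 (2 * tau m) a b ((1/2)^(7*m)) hv0.ne' (by positivity) (by positivity)
  rw [abs_of_pos hv0] at h
  have h2 : volume.real (hbx a b ((1/2)^(7*m)) ∩ T v.1 v.2 (tau m) (2 * tau m)) ≤ 
      (v.1 * (1/2)^(7*m) + 2) * (2 * (2 * tau m) / v.1) * (1/2)^(7*m) := by
    apply real_le_of (by positivity)
    exact le_trans (measure_mono (Set.inter_subset_inter (hbx_sub _ _ _) (T_sub_S _ _ _ _))) h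
  refine h2.trans ?_
  have h4 : (1:ℝ) ≤ v.1 * (1/2)^(7*m) := by
    rw [one_div_pow, mul_one_div, le_div_iff₀ (by positivity)]; linarith
  have e : ((1:ℝ)/4)^(7*m) = (1/2)^(7*m) * (1/2)^(7*m) := by rw [← mul_pow]; norm_num
  calc _ ≤ (3 * v.1 * (1/2)^(7*m)) * (2 * (2 * tau m) / v.1) * (1/2)^(7*m) := by gcongr; linarith
      _ = _ := by rw [e]; field_simp; ring
end MB

namespace MB
open MeasureTheory

/-- dyadic half-open square -/
noncomputable def sq (n : ℕ) (q : ℤ × ℤ) : Set (ℝ × ℝ) :=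
  hbx (q.1 * (1/2)^n) (q.2 * (1/2)^n) ((1/2)^n)
/-- dyadic closed square -/
noncomputable def csq (n : ℕ) (q : ℤ × ℤ) : Set (ℝ × ℝ) :=
  bx (q.1 * (1/2)^n) (q.2 * (1/2)^n) ((1/2)^n)

lemma meas_sq (n : ℕ) (q : ℤ × ℤ) : MeasurableSet (sq n q) := meas_hbx _ _ _
lemma sq_sub (n : ℕ) (q : ℤ × ℤ) : sq n q ⊆ csq n q := hbx_sub _ _ _

lemma vol_sq (n : ℕ) (q : ℤ × ℤ) : volume.real (sq n q) = (1/4)^n := by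
  have e : ((1:ℝ)/4)^n = (1/2)^n * (1/2)^n := by rw [← mul_pow]; norm_num
  rw [sq, hbx, Measure.real, Measure.volume_eq_prod, Measure.prod_prod, Real.volume_Ico,
    Real.volume_Ico, add_sub_cancel_left, add_sub_cancel_left, ← ENNReal.ofReal_mul (by positivity),
    ENNReal.toReal_ofReal (by positivity), e]

/-- index of the square containing a point -/
noncomputable def idx (n : ℕ) (z : ℝ × ℝ) : ℤ × ℤ := (⌊z.1 * 2^n⌋, ⌊z.2 * 2^n⌋)

lemma mem_sq_iff (n : ℕ) (q : ℤ × ℤ) (z : ℝ × ℝ) : z ∈ sq n q ↔ idx n z = q := by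
  have h2 : (0:ℝ) < 2^n := by positivity
  have aux : ∀ (x : ℝ) (i : ℤ), (x ∈ Set.Ico ((i:ℝ) * (1/2)^n) ((i:ℝ) * (1/2)^n + (1/2)^n)) ↔ ⌊x * 2^n⌋ = i := by
    intro x i
    rw [Int.floor_eq_iff, Set.mem_Ico, one_div_pow]
    have e : (i:ℝ) * (1 / 2^n) + 1 / 2^n = (i + 1) / 2^n := by ring
    rw [e, mul_one_div]
    rw [div_le_iff₀ h2, lt_div_iff₀ h2]
  rw [sq, hbx, Set.mem_prod, aux, aux, idx, Prod.ext_iff]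

lemma mem_csq {n : ℕ} {q : ℤ × ℤ} {z : ℝ × ℝ} (h : z ∈ csq n q) :
    (q.1 * (1/2)^n ≤ z.1 ∧ z.1 ≤ q.1 * (1/2)^n + (1/2)^n) ∧
    (q.2 * (1/2)^n ≤ z.2 ∧ z.2 ≤ q.2 * (1/2)^n + (1/2)^n) := h

/-- ancestor -/
def anc (d : ℕ) (q : ℤ × ℤ) : ℤ × ℤ := (q.1 / (2^d : ℕ), q.2 / (2^d : ℕ))

lemma idx_anc (n d : ℕ) (z : ℝ × ℝ) : anc d (idx (n + d) z) = idx n z := by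
  have aux : ∀ x : ℝ, ⌊x * 2^(n+d)⌋ / ((2^d : ℕ) : ℤ) = ⌊x * 2^n⌋ := by
    intro x
    rw [← Int.floor_div_natCast]
    congr 1
    push_cast
    rw [pow_add]
    field_simp
  simp only [anc, idx, aux]

lemma sq_nonempty (n : ℕ) (q : ℤ × ℤ) : (sq n q).Nonempty := by
  refine ⟨(q.1 * (1/2)^n, q.2 * (1/2)^n), ?_⟩
  have : (0:ℝ) < (1/2)^n := by positivity
  exact ⟨⟨le_refl _, by simpa using this⟩, ⟨le_refl _, by simpa using this⟩⟩

/-- descendants -/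
noncomputable def kids (d : ℕ) (q : ℤ × ℤ) : Finset (ℤ × ℤ) :=
  Finset.Ico (q.1 * (2^d : ℕ)) ((q.1 + 1) * (2^d : ℕ)) ×ˢ
  Finset.Ico (q.2 * (2^d : ℕ)) ((q.2 + 1) * (2^d : ℕ))

lemma mem_kids (d : ℕ) (q p : ℤ × ℤ) : p ∈ kids d q ↔ anc d p = q := by
  have aux : ∀ i j : ℤ, i ∈ Finset.Ico (j * ((2^d : ℕ):ℤ)) ((j + 1) * ((2^d : ℕ):ℤ)) ↔ i / ((2^d : ℕ):ℤ) = j := by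
    intro i j
    rw [Finset.mem_Ico, Int.ediv_eq_iff_of_pos (by positivity)]
    constructor
    · rintro ⟨h1, h2⟩; constructor <;> linarith
    · rintro ⟨h1, h2⟩; constructor <;> linarith
  rw [kids, Finset.mem_product, aux, aux, anc, Prod.ext_iff]

lemma kid_sub (n d : ℕ) (q p : ℤ × ℤ) (h : p ∈ kids d q) : sq (n+d) p ⊆ sq n q := by
  intro z hz
  rw [mem_sq_iff] at hz ⊢
  rw [← idx_anc n d, hz]
  exact (mem_kids d q p).mp h

lemma kid_exists (n d : ℕ) (q : ℤ × ℤ) (z : ℝ × ℝ) (hz : z ∈ sq n q) : idx (n+d) z ∈ kids d q := by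
  rw [mem_kids, idx_anc]
  exact (mem_sq_iff n q z).mp hz

lemma mem_sq_idx (n : ℕ) (z : ℝ × ℝ) : z ∈ sq n (idx n z) := (mem_sq_iff _ _ _).mpr rfl

lemma sq_disj (n : ℕ) (s : Set (ℤ × ℤ)) : s.PairwiseDisjoint (sq n) := by
  intro p _ q _ hpq
  rw [Function.onFun, Set.disjoint_left]
  intro z hz hzz
  rw [mem_sq_iff] at hz hzz
  exact hpq (hz.symm.trans hzz)

/-- sum over disjoint squares -/
lemma sum_sq_le (n d : ℕ) (q : ℤ × ℤ) (K : Finset (ℤ × ℤ)) (hK : K ⊆ kids d q) (E : Set (ℝ × ℝ))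
    (hE : MeasurableSet E) :
    ∑ p ∈ K, volume.real (sq (n+d) p ∩ E) ≤ volume.real (sq n q ∩ E) := by
  have hfin : ∀ (k : ℕ) (p : ℤ × ℤ), volume (sq k p ∩ E) ≠ ⊤ := fun k p =>
    measure_ne_top_of_subset Set.inter_subset_left (vol_hbx_ne_top _ _ _)
  rw [← measureReal_biUnion_finset (fun p hp q hq hpq =>
      (sq_disj (n+d) Set.univ (Set.mem_univ p) (Set.mem_univ q) hpq).mono Set.inter_subset_left Set.inter_subset_left)
      (fun p _ => (meas_sq _ _).inter hE) (fun p _ => hfin _ _)]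
  apply measureReal_mono _ (hfin _ _)
  intro z hz
  simp only [Set.mem_iUnion] at hz
  obtain ⟨p, hp, hz⟩ := hz
  exact ⟨kid_sub n d q p (hK hp) hz.1, hz.2⟩

lemma bonf {α : Type*} [MeasurableSpace α] (μ : Measure α) [IsFiniteMeasure μ] {ι : Type*}
    [DecidableEq ι] (s : Finset ι) (A : ι → Set α) (hA : ∀ i, MeasurableSet (A i)) :
    ∑ i ∈ s, μ.real (A i) - ∑ i ∈ s, ∑ j ∈ s.erase i, μ.real (A j ∩ A i) ≤
      μ.real (⋃ i ∈ s, A i) := by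
  induction s using Finset.induction_on with
  | empty => simp
  | insert k s hk ih =>
    have hU : (⋃ i ∈ insert k s, A i) = A k ∪ ⋃ i ∈ s, A i := by simp
    have hm : MeasurableSet (⋃ i ∈ s, A i) := Finset.measurableSet_biUnion _ fun i _ => hA i
    have h1 := measureReal_union_add_inter (μ := μ) (s := A k) (t := ⋃ i ∈ s, A i) hm
      (measure_ne_top _ _) (measure_ne_top _ _)
    have h2 : μ.real (A k ∩ ⋃ i ∈ s, A i) ≤ ∑ j ∈ s, μ.real (A j ∩ A k) := by
      rw [Set.inter_comm, Set.iUnion₂_inter]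
      exact measureReal_biUnion_finset_le s (fun i => A i ∩ A k)
    have h3 : ∑ i ∈ s, ∑ j ∈ s.erase i, μ.real (A j ∩ A i) ≤
        ∑ i ∈ s, ∑ j ∈ (insert k s).erase i, μ.real (A j ∩ A i) := by
      apply Finset.sum_le_sum
      intro i _
      apply Finset.sum_le_sum_of_subset_of_nonneg
      · exact Finset.erase_subset_erase _ (Finset.subset_insert _ _)
      · intros; positivity
    rw [hU, Finset.sum_insert hk, Finset.sum_insert hk, Finset.erase_insert hk]
    linarith

end MB

namespace MB
open MeasureTheory

/-- total measure of the strips of B inside a square -/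
noncomputable def Load (n : ℕ) (B : Finset (ℕ × ℕ)) (q : ℤ × ℤ) : ℝ :=
  ∑ v ∈ B, volume.real (sq n q ∩ S v.1 v.2 (2 * dl n v))

/-- good children -/
def StepGood (m : ℕ) (B : Finset (ℕ × ℕ)) (p : ℤ × ℤ) : Prop :=
  (∀ v ∈ B, ∀ z ∈ csq (24*m) p, dl m v < nint (v.1 * z.1 + v.2 * z.2)) ∧
  (∃ v ∈ V0 (2^(7*m)), ∀ z ∈ csq (24*m) p, nint (v.1 * z.1 + v.2 * z.2) ≤ 3 * tau m) ∧
  Load (24*m) (block m) p ≤ 1 / 48 * (1/4)^(24*m)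

lemma move (n : ℕ) (p : ℤ × ℤ) (x y : ℝ) (hx : 0 ≤ x) (hy : 0 ≤ y) (z w : ℝ × ℝ) (hz : z ∈ csq n p)
    (hw : w ∈ csq n p) :
    nint (x * z.1 + y * z.2) ≤ nint (x * w.1 + y * w.2) + (x + y) * (1/2)^n := by
  refine (nint_le_add _ (x * w.1 + y * w.2)).trans ?_
  obtain ⟨⟨a1, a2⟩, a3, a4⟩ := mem_csq hz
  obtain ⟨⟨b1, b2⟩, b3, b4⟩ := mem_csq hw
  have h1 : |z.1 - w.1| ≤ (1/2)^n := by rw [abs_le]; constructor <;> linarith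
  have h2 : |z.2 - w.2| ≤ (1/2)^n := by rw [abs_le]; constructor <;> linarith
  have : |x * z.1 + y * z.2 - (x * w.1 + y * w.2)| ≤ (x + y) * (1/2)^n := by
    calc _ = |x * (z.1 - w.1) + y * (z.2 - w.2)| := by congr 1; ring
      _ ≤ |x * (z.1 - w.1)| + |y * (z.2 - w.2)| := abs_add_le _ _
      _ = x * |z.1 - w.1| + y * |z.2 - w.2| := by rw [abs_mul, abs_mul, abs_of_nonneg hx, abs_of_nonneg hy]
      _ ≤ x * (1/2)^n + y * (1/2)^n := by gcongr
      _ = _ := by ring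
  linarith

lemma margin1 (m : ℕ) (hm : 40 ≤ m) (v : ℕ × ℕ) (hv : v ∈ bigbox (2^(2*m))) (n : ℕ) (hn : 7*m ≤ n) :
    ((v.1:ℝ) + v.2) * (1/2)^n ≤ dl m v / 2 := by
  simp only [bigbox, Finset.mem_product, Finset.mem_Icc] at hv
  have h1 : (1:ℝ) ≤ v.1 := by exact_mod_cast hv.1.1
  have h2 : (1:ℝ) ≤ v.2 := by exact_mod_cast hv.2.1
  have h3 : (v.1:ℝ) ≤ (2^m)^2 := by rw [← pow_mul, mul_comm m]; exact_mod_cast hv.1.2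
  have h4 : (v.2:ℝ) ≤ (2^m)^2 := by rw [← pow_mul, mul_comm m]; exact_mod_cast hv.2.2
  have h5 : (1/2:ℝ)^n ≤ 1 / (2^m)^7 := by
    rw [← pow_mul, mul_comm m, ← one_div_pow]
    exact pow_le_pow_of_le_one (by norm_num) (by norm_num) hn
  have h6 := big_pow' m hm
  have h7 : (40:ℝ) ≤ m := by exact_mod_cast hm
  set P : ℝ := 2^m
  have hP : 0 < P := by positivity
  calc ((v.1:ℝ) + v.2) * (1/2)^n ≤ (P^2 + P^2) * (1 / P^7) := by gcongr
    _ = 2 / P^5 := by field_simp; norm_num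
    _ ≤ 1 / 10000000 / (P^2 * P^2 * (m:ℝ)^2) / 2 := by
        rw [div_div, div_div, div_le_div_iff₀ (by positivity) (by positivity)]
        have : 0 < P^4 := by positivity
        nlinarith
    _ ≤ _ := by unfold dl; gcongr

lemma margin2 (m : ℕ) (hm : 40 ≤ m) (v : ℕ × ℕ) (hv : v ∈ V0 (2^(7*m))) :
    ((v.1:ℝ) + v.2) * (1/2)^(24*m) ≤ tau m / 2 := by
  rw [mem_V0] at hv
  have h3 : (v.1:ℝ) ≤ 2 * (2^m)^7 := by rw [← pow_mul, mul_comm m]; exact_mod_cast hv.1.2.le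
  have h4 : (v.2:ℝ) ≤ 2 * (2^m)^7 := by rw [← pow_mul, mul_comm m]; exact_mod_cast hv.2.2.le
  have h6 := big_pow' m hm
  have h7 : (40:ℝ) ≤ m := by exact_mod_cast hm
  have e : (1/2:ℝ)^(24*m) = 1 / (2^m)^24 := by rw [← pow_mul, mul_comm m, one_div_pow]
  have e2 : (2:ℝ)^(7*m) = (2^m)^7 := by rw [← pow_mul, mul_comm m]
  rw [e, tau, e2]
  have h1 : (1:ℝ) ≤ 2^m := one_le_pow₀ (by norm_num)
  set P : ℝ := 2^m
  have hP : 0 < P := by positivity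
  calc ((v.1:ℝ) + v.2) * (1 / P^24) ≤ (2 * P^7 + 2 * P^7) * (1 / P^24) := by gcongr
    _ = 4 / P^17 := by field_simp; norm_num
    _ ≤ 1 / ((P^7)^2 * (24 * m)^2) / 2 := by
        rw [div_div, div_le_div_iff₀ (by positivity) (by positivity)]
        have h8 : P ≤ P^3 := by nlinarith [sq_nonneg P]
        have : 0 < P^14 := by positivity
        have e3 : P^17 = P^14 * P^3 := by ring
        have h9 : 4608 * (m:ℝ)^2 ≤ P^3 := by nlinarith
        rw [e3]
        nlinarith

open Classical in
lemma step (m : ℕ) (hm : 40 ≤ m) (B : Finset (ℕ × ℕ)) (hB : B ⊆ bigbox (2^(2*m))) (q : ℤ × ℤ)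
    (hq : Load m B q ≤ 1 / 48 * (1/4)^m) :
    (4:ℝ)^(23*m) / (64 * (24*m)^2) ≤ ((kids (23*m) q).filter (StepGood m B)).card := by
  have ht := tau_pos m (by omega)
  set Vv := V (2^(7*m)) with hVv
  have hVsub : ∀ v ∈ Vv, v ∈ V0 (2^(7*m)) := fun v hv => (Finset.mem_filter.mp hv).1
  set Tv : ℕ × ℕ → Set (ℝ × ℝ) := fun v => T v.1 v.2 (tau m) (2 * tau m) with hTv
  have hTm : ∀ v, MeasurableSet (Tv v) := fun v => meas_T _ _ _ _
  set U : Set (ℝ × ℝ) := ⋃ v ∈ Vv, Tv v with hU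
  have hUm : MeasurableSet U := Finset.measurableSet_biUnion _ fun v _ => hTm v
  have hfin : ∀ (k : ℕ) (p : ℤ × ℤ) (E : Set (ℝ × ℝ)), volume (sq k p ∩ E) ≠ ⊤ := fun k p E =>
    measure_ne_top_of_subset Set.inter_subset_left (vol_hbx_ne_top _ _ _)
  have e7 : m + 6 * m = 7 * m := by ring
  have e24 : m + 23 * m = 24 * m := by ring
  -- dirty mids
  set Dk := (kids (6*m) q).filter (fun p => ∃ v ∈ B, ∃ z ∈ sq (7*m) p,
    nint (v.1 * z.1 + v.2 * z.2) ≤ 3 / 2 * dl m v) with hDk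
  have claimA : (Dk.card : ℝ) * (1/4)^(7*m) ≤ 1 / 48 * (1/4)^m := by
    calc (Dk.card : ℝ) * (1/4)^(7*m) = ∑ p ∈ Dk, volume.real (sq (7*m) p) := by
          simp_rw [vol_sq]; rw [Finset.sum_const, nsmul_eq_mul]
      _ ≤ ∑ p ∈ Dk, ∑ v ∈ B, volume.real (sq (7*m) p ∩ S v.1 v.2 (2 * dl m v)) := by
          apply Finset.sum_le_sum
          intro p hp
          obtain ⟨-, v, hv, z, hz, hzn⟩ := Finset.mem_filter.mp hp
          have hsub : sq (7*m) p ⊆ S v.1 v.2 (2 * dl m v) := by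
            intro w hw
            have h1 := move (7*m) p v.1 v.2 (by positivity) (by positivity) w z (sq_sub _ _ hw) (sq_sub _ _ hz)
            have h2 := margin1 m hm v (hB hv) (7*m) le_rfl
            change nint _ ≤ _
            linarith
          have : volume.real (sq (7*m) p) = volume.real (sq (7*m) p ∩ S v.1 v.2 (2 * dl m v)) := by
            rw [Set.inter_eq_left.mpr hsub]
          rw [this]
          exact Finset.single_le_sum (f := fun v : ℕ × ℕ => volume.real (sq (7*m) p ∩ S v.1 v.2 (2 * dl m v)))
            (fun _ _ => measureReal_nonneg) hv
      _ = ∑ v ∈ B, ∑ p ∈ Dk, volume.real (sq (7*m) p ∩ S v.1 v.2 (2 * dl m v)) := Finset.sum_comm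
      _ ≤ ∑ v ∈ B, volume.real (sq m q ∩ S v.1 v.2 (2 * dl m v)) := by
          apply Finset.sum_le_sum
          intro v _
          rw [← e7]
          exact sum_sq_le m (6*m) q Dk (Finset.filter_subset _ _) _ (meas_S _ _ _)
      _ ≤ _ := hq
  set D : Set (ℝ × ℝ) := ⋃ p ∈ Dk, sq (7*m) p with hD
  have claimB : volume.real (sq m q ∩ (U ∩ D)) ≤ Vv.card * (tau m * (1/4)^m / 4) := by
    have h1 : sq m q ∩ (U ∩ D) ⊆ ⋃ p ∈ Dk, ⋃ v ∈ Vv, (sq (7*m) p ∩ Tv v) := by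
      rintro z ⟨-, hzU, hzD⟩
      simp only [hU, hD, Set.mem_iUnion] at hzU hzD ⊢
      obtain ⟨v, hv, hzv⟩ := hzU
      obtain ⟨p, hp, hzp⟩ := hzD
      exact ⟨p, hp, v, hv, hzp, hzv⟩
    have hf : ∀ p, volume (⋃ v ∈ Vv, (sq (7*m) p ∩ Tv v)) ≠ ⊤ := by
      intro p
      refine measure_ne_top_of_subset ?_ (hfin (7*m) p Set.univ)
      simp only [Set.iUnion_subset_iff]
      intro v _
      exact Set.inter_subset_inter_right _ (Set.subset_univ _)
    have h2 : volume (⋃ p ∈ Dk, ⋃ v ∈ Vv, (sq (7*m) p ∩ Tv v)) ≠ ⊤ := by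
      refine ((measure_biUnion_finset_le _ _).trans_lt ?_).ne
      exact ENNReal.sum_lt_top.mpr fun p _ => (hf p).lt_top
    calc _ ≤ _ := measureReal_mono h1 h2
      _ ≤ ∑ p ∈ Dk, volume.real (⋃ v ∈ Vv, (sq (7*m) p ∩ Tv v)) := measureReal_biUnion_finset_le _ _
      _ ≤ ∑ p ∈ Dk, ∑ v ∈ Vv, volume.real (sq (7*m) p ∩ Tv v) :=
          Finset.sum_le_sum fun p _ => measureReal_biUnion_finset_le _ _
      _ ≤ ∑ p ∈ Dk, ∑ v ∈ Vv, 12 * tau m * (1/4)^(7*m) := by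
          apply Finset.sum_le_sum; intro p _
          apply Finset.sum_le_sum; intro v hv
          exact L4 m hm _ _ v (hVsub v hv)
      _ = 12 * tau m * Vv.card * (Dk.card * (1/4)^(7*m)) := by
          simp only [Finset.sum_const, nsmul_eq_mul]; ring
      _ ≤ 12 * tau m * Vv.card * (1 / 48 * (1/4)^m) := by gcongr
      _ = _ := by ring
  set G := (kids (23*m) q).filter (StepGood m B) with hG
  set Bd := (kids (23*m) q).filter (fun p => (∃ z ∈ sq (24*m) p, z ∈ U ∧ z ∉ D) ∧ ¬ StepGood m B p) with hBd
  have claimC : ∀ p ∈ Bd, 1 / 48 * (1/4)^(24*m) ≤ ∑ v ∈ Vv, ∑ w ∈ block m,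
      volume.real (sq (24*m) p ∩ (T v.1 v.2 (tau m / 2) (3 * tau m) ∩ S w.1 w.2 (2 * dl (24*m) w))) := by
    intro p hp
    obtain ⟨hpk, ⟨z, hzp, hzU, hzD⟩, hng⟩ := Finset.mem_filter.mp hp
    have hzq : z ∈ sq m q := by
      apply kid_sub m (23*m) q p hpk
      rw [e24]; exact hzp
    simp only [hU, Set.mem_iUnion] at hzU
    obtain ⟨v, hv, hzv⟩ := hzU
    have hsub : csq (24*m) p ⊆ T v.1 v.2 (tau m / 2) (3 * tau m) := by
      intro w hw
      have h1 := move (24*m) p v.1 v.2 (by positivity) (by positivity) w z hw (sq_sub _ _ hzp)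
      have h2 := move (24*m) p v.1 v.2 (by positivity) (by positivity) z w (sq_sub _ _ hzp) hw
      have h3 := margin2 m hm v (hVsub v hv)
      have h4 := hzv.1
      have h5 := hzv.2
      constructor <;> linarith
    have havoid : ∀ u ∈ B, ∀ w ∈ csq (24*m) p, dl m u < nint (u.1 * w.1 + u.2 * w.2) := by
      intro u hu w hw
      have h2 := move (24*m) p u.1 u.2 (by positivity) (by positivity) z w (sq_sub _ _ hzp) hw
      have h3 := margin1 m hm u (hB hu) (24*m) (by omega)
      have h4 : 3 / 2 * dl m u < nint (u.1 * z.1 + u.2 * z.2) := by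
        by_contra hcon
        apply hzD
        simp only [hD, Set.mem_iUnion]
        have hk := kid_exists m (6*m) q z hzq
        rw [e7] at hk
        exact ⟨idx (7*m) z, Finset.mem_filter.mpr ⟨hk, u, hu, z, mem_sq_idx _ _, not_lt.mp hcon⟩, mem_sq_idx _ _⟩
      linarith
    have hload : 1 / 48 * (1/4)^(24*m) < Load (24*m) (block m) p := by
      by_contra hcon
      exact hng ⟨havoid, ⟨v, hVsub v hv, fun w hw => (hsub hw).2⟩, not_lt.mp hcon⟩
    refine hload.le.trans ?_
    have h1 : Load (24*m) (block m) p = ∑ w ∈ block m,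
        volume.real (sq (24*m) p ∩ (T v.1 v.2 (tau m / 2) (3 * tau m) ∩ S w.1 w.2 (2 * dl (24*m) w))) := by
      apply Finset.sum_congr rfl
      intro w _
      congr 1
      rw [← Set.inter_assoc, Set.inter_eq_left.mpr ((sq_sub _ _).trans hsub)]
    rw [h1]
    exact Finset.single_le_sum (f := fun v : ℕ × ℕ => ∑ w ∈ block m,
      volume.real (sq (24*m) p ∩ (T v.1 v.2 (tau m / 2) (3 * tau m) ∩ S w.1 w.2 (2 * dl (24*m) w))))
      (fun _ _ => Finset.sum_nonneg fun _ _ => measureReal_nonneg) hv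
  have claimD : (Bd.card : ℝ) * (1/4)^(24*m) ≤ Vv.card * (tau m * (1/4)^m / 16) := by
    have h1 : (Bd.card : ℝ) * (1 / 48 * (1/4)^(24*m)) ≤ Vv.card * (tau m * (1/4)^m / 768) := by
      rw [← nsmul_eq_mul]
      calc _ ≤ ∑ p ∈ Bd, ∑ v ∈ Vv, ∑ w ∈ block m, volume.real (sq (24*m) p ∩
            (T v.1 v.2 (tau m / 2) (3 * tau m) ∩ S w.1 w.2 (2 * dl (24*m) w))) :=
            Finset.card_nsmul_le_sum _ _ _ claimC
        _ = ∑ v ∈ Vv, ∑ w ∈ block m, ∑ p ∈ Bd, volume.real (sq (24*m) p ∩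
            (T v.1 v.2 (tau m / 2) (3 * tau m) ∩ S w.1 w.2 (2 * dl (24*m) w))) := by
            rw [Finset.sum_comm]
            apply Finset.sum_congr rfl; intro v _
            rw [Finset.sum_comm]
        _ ≤ ∑ v ∈ Vv, ∑ w ∈ block m, volume.real (sq m q ∩
            (T v.1 v.2 (tau m / 2) (3 * tau m) ∩ S w.1 w.2 (2 * dl (24*m) w))) := by
            apply Finset.sum_le_sum; intro v _
            apply Finset.sum_le_sum; intro w _
            rw [← e24]
            exact sum_sq_le m (23*m) q Bd (Finset.filter_subset _ _) _ ((meas_T _ _ _ _).inter (meas_S _ _ _))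
        _ ≤ _ := by
            refine le_trans (le_of_eq ?_) (L3 m hm (q.1 * (1/2)^m) (q.2 * (1/2)^m))
            apply Finset.sum_congr rfl; intro v _
            apply Finset.sum_congr rfl; intro w _
            rw [muQ_real _ _ _ ((meas_T _ _ _ _).inter (meas_S _ _ _)), sq]
    linarith
  have claimE : volume.real (sq m q ∩ U) ≤ volume.real (sq m q ∩ (U ∩ D)) +
      (G.card * (1/4)^(24*m) + Bd.card * (1/4)^(24*m)) := by
    have hs : ∀ K : Finset (ℤ × ℤ), volume (⋃ p ∈ K, sq (24*m) p) ≠ ⊤ := by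
      intro K
      refine ((measure_biUnion_finset_le _ _).trans_lt ?_).ne
      exact ENNReal.sum_lt_top.mpr fun p _ => (vol_hbx_ne_top _ _ _).lt_top
    have hs2 : ∀ K : Finset (ℤ × ℤ), volume.real (⋃ p ∈ K, sq (24*m) p) ≤ K.card * (1/4)^(24*m) := by
      intro K
      refine (measureReal_biUnion_finset_le _ _).trans (le_of_eq ?_)
      simp_rw [vol_sq]; rw [Finset.sum_const, nsmul_eq_mul]
    have hsub : sq m q ∩ U ⊆ (sq m q ∩ (U ∩ D)) ∪ ((⋃ p ∈ G, sq (24*m) p) ∪ ⋃ p ∈ Bd, sq (24*m) p) := by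
      rintro z ⟨hzq, hzU⟩
      by_cases hzD : z ∈ D
      · exact Or.inl ⟨hzq, hzU, hzD⟩
      · right
        have hk := kid_exists m (23*m) q z hzq
        rw [e24] at hk
        have hz := mem_sq_idx (24*m) z
        by_cases hg : StepGood m B (idx (24*m) z)
        · left
          simp only [Set.mem_iUnion]
          exact ⟨_, Finset.mem_filter.mpr ⟨hk, hg⟩, hz⟩
        · right
          simp only [Set.mem_iUnion]
          exact ⟨_, Finset.mem_filter.mpr ⟨hk, ⟨z, hz, hzU, hzD⟩, hg⟩, hz⟩
    refine (measureReal_mono hsub (measure_union_ne_top (hfin _ _ _)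
      (measure_union_ne_top (hs _) (hs _)))).trans ?_
    refine (measureReal_union_le _ _).trans ?_
    gcongr
    refine (measureReal_union_le _ _).trans ?_
    exact add_le_add (hs2 _) (hs2 _)
  have claimF : Vv.card * (tau m * (1/4)^m * (7/16)) ≤ volume.real (sq m q ∩ U) := by
    have h1 := bonf (muQ (q.1 * (1/2)^m) (q.2 * (1/2)^m) ((1/2)^m)) Vv Tv hTm
    rw [← hU, muQ_real _ _ _ hUm] at h1
    have h2 := L2 m hm (q.1 * (1/2)^m) (q.2 * (1/2)^m)
    have h3 : (Vv.card : ℝ) * (tau m * (1/4)^m / 2) ≤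
        ∑ v ∈ Vv, (muQ (q.1 * (1/2)^m) (q.2 * (1/2)^m) ((1/2)^m)).real (Tv v) := by
      rw [← nsmul_eq_mul]
      exact Finset.card_nsmul_le_sum _ _ _ fun v hv => L1 m hm _ _ v (hVsub v hv)
    change _ ≤ volume.real (hbx _ _ _ ∩ U)
    linarith
  have hcard := card_V' m hm
  rw [← hVv] at hcard
  have hmr : (40:ℝ) ≤ m := by exact_mod_cast hm
  have hfinal : Vv.card * (tau m * (1/4)^m * (1/8)) ≤ G.card * (1/4)^(24*m) := by linarith
  have h1 : (1/4:ℝ)^m * (1 / (64 * (24*m)^2)) ≤ G.card * (1/4)^(24*m) := by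
    refine le_trans ?_ hfinal
    calc (1/4:ℝ)^m * (1 / (64 * (24*m)^2)) = ((2:ℝ)^(7*m))^2 / 8 * (tau m * (1/4)^m * (1/8)) := by
          rw [tau]; field_simp; norm_num
      _ ≤ _ := by gcongr
  have h2 : (4:ℝ)^(24*m) * (1/4)^(24*m) = 1 := by rw [← mul_pow]; norm_num
  have h3 : (4:ℝ)^(24*m) * (1/4)^m = 4^(23*m) := by
    rw [← e24, add_comm, pow_add, mul_assoc, ← mul_pow]; norm_num
  have h4 := mul_le_mul_of_nonneg_left h1 (show (0:ℝ) ≤ 4^(24*m) by positivity)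
  rw [← mul_assoc, h3, mul_one_div] at h4
  calc _ ≤ _ := h4
    _ = G.card * ((4:ℝ)^(24*m) * (1/4)^(24*m)) := by ring
    _ = _ := by rw [h2, mul_one]

end MB

namespace MB
open MeasureTheory

/-- nodes along a branch -/
def node {N : ℕ → ℕ} (ch : ∀ k, ℤ × ℤ → Fin (N k) → ℤ × ℤ) (r : ℤ × ℤ) (x : ∀ k, Fin (N k)) :
    ℕ → ℤ × ℤ
  | 0 => r
  | k+1 => ch k (node ch r x k) (x k)

lemma card_meet (n : ℕ) (c d : ℝ) (hd : (1/2)^n ≤ d) :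
    ((Finset.Icc ⌈(c - d) * 2^n - 1⌉ ⌊(c + d) * 2^n⌋).card : ℝ) ≤ 4 * (d * 2^n) := by
  have h2 : (0:ℝ) < 2^n := by positivity
  have h1 : 1 ≤ d * 2^n := by
    rw [one_div_pow, div_le_iff₀ h2] at hd; exact hd
  rw [Int.card_Icc]
  rcases le_total (⌊(c + d) * 2^n⌋ + 1 - ⌈(c - d) * 2^n - 1⌉) 0 with h | h
  · rw [Int.toNat_of_nonpos h]; push_cast; linarith
  · have : ((⌊(c + d) * 2^n⌋ + 1 - ⌈(c - d) * 2^n - 1⌉).toNat : ℝ) =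
        ((⌊(c + d) * 2^n⌋ + 1 - ⌈(c - d) * 2^n - 1⌉ : ℤ) : ℝ) := by
      exact_mod_cast congrArg (Int.cast : ℤ → ℝ) (Int.toNat_of_nonneg h)
    rw [this]
    push_cast
    have a1 := Int.floor_le ((c + d) * 2^n)
    have a2 := Int.le_ceil ((c - d) * 2^n - 1)
    linarith

lemma mem_meet (n : ℕ) (c d : ℝ) (i : ℤ) (t : ℝ) (h1 : i * (1/2)^n ≤ t) (h2 : t ≤ i * (1/2)^n + (1/2)^n)
    (h3 : c - d ≤ t) (h4 : t ≤ c + d) : i ∈ Finset.Icc ⌈(c - d) * 2^n - 1⌉ ⌊(c + d) * 2^n⌋ := by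
  have hp : (0:ℝ) < 2^n := by positivity
  have e : (1/2:ℝ)^n * 2^n = 1 := by rw [← mul_pow]; norm_num
  rw [Finset.mem_Icc, Int.ceil_le, Int.le_floor]
  have a1 := mul_le_mul_of_nonneg_right h1 hp.le
  have a2 := mul_le_mul_of_nonneg_right h2 hp.le
  have a3 := mul_le_mul_of_nonneg_right h3 hp.le
  have a4 := mul_le_mul_of_nonneg_right h4 hp.le
  rw [mul_assoc, e] at a1
  rw [add_mul, mul_assoc, e] at a2
  constructor <;> linarith

lemma kid_csq (n d : ℕ) (q p : ℤ × ℤ) (h : p ∈ kids d q) :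
    ((q.1:ℝ) * (1/2)^n ≤ p.1 * (1/2)^(n+d) ∧ (p.1:ℝ) * (1/2)^(n+d) + (1/2)^(n+d) ≤ q.1 * (1/2)^n + (1/2)^n) ∧
    ((q.2:ℝ) * (1/2)^n ≤ p.2 * (1/2)^(n+d) ∧ (p.2:ℝ) * (1/2)^(n+d) + (1/2)^(n+d) ≤ q.2 * (1/2)^n + (1/2)^n) := by
  have aux : ∀ i j : ℤ, i ∈ Finset.Ico (j * ((2^d : ℕ):ℤ)) ((j + 1) * ((2^d : ℕ):ℤ)) →
      ((j:ℝ) * (1/2)^n ≤ i * (1/2)^(n+d) ∧ (i:ℝ) * (1/2)^(n+d) + (1/2)^(n+d) ≤ j * (1/2)^n + (1/2)^n) := by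
    intro i j hi
    rw [Finset.mem_Ico] at hi
    have h1 : (j:ℝ) * 2^d ≤ i := by exact_mod_cast hi.1
    have h2 : (i:ℝ) + 1 ≤ (j + 1) * 2^d := by exact_mod_cast hi.2
    have e : (1/2:ℝ)^n = 2^d * (1/2)^(n+d) := by
      rw [pow_add, mul_comm, mul_assoc, ← mul_pow]; norm_num
    have hp : (0:ℝ) < (1/2)^(n+d) := by positivity
    rw [e]
    constructor <;> nlinarith
  rw [kids, Finset.mem_product] at h
  exact ⟨aux _ _ h.1, aux _ _ h.2⟩


lemma node_good (M d N : ℕ → ℕ) (hM : ∀ k, M (k+1) = M k + d k) (hN : ∀ k, 1 ≤ N k)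
    (Good : ℕ → ℤ × ℤ → Prop) (r : ℤ × ℤ) (hr : Good 0 r)
    (ch : ∀ k, ℤ × ℤ → Fin (N k) → ℤ × ℤ)
    (hch : ∀ k q, Good k q → Function.Injective (ch k q) ∧
      ∀ i, ch k q i ∈ kids (d k) q ∧ Good (k+1) (ch k q i))
    (x : ∀ k, Fin (N k)) (k : ℕ) : Good k (node ch r x k) := by
  induction k with
  | zero => exact hr
  | succ k ih => exact ((hch k _ ih).2 (x k)).2

lemma node_kid (M d N : ℕ → ℕ) (hM : ∀ k, M (k+1) = M k + d k) (hN : ∀ k, 1 ≤ N k)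
    (Good : ℕ → ℤ × ℤ → Prop) (r : ℤ × ℤ) (hr : Good 0 r)
    (ch : ∀ k, ℤ × ℤ → Fin (N k) → ℤ × ℤ)
    (hch : ∀ k q, Good k q → Function.Injective (ch k q) ∧
      ∀ i, ch k q i ∈ kids (d k) q ∧ Good (k+1) (ch k q i))
    (x : ∀ k, Fin (N k)) (k : ℕ) : node ch r x (k+1) ∈ kids (d k) (node ch r x k) :=
  ((hch k _ (node_good M d N hM hN Good r hr ch hch x k)).2 (x k)).1

lemma node_inj (M d N : ℕ → ℕ) (hM : ∀ k, M (k+1) = M k + d k) (hN : ∀ k, 1 ≤ N k)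
    (Good : ℕ → ℤ × ℤ → Prop) (r : ℤ × ℤ) (hr : Good 0 r)
    (ch : ∀ k, ℤ × ℤ → Fin (N k) → ℤ × ℤ)
    (hch : ∀ k q, Good k q → Function.Injective (ch k q) ∧
      ∀ i, ch k q i ∈ kids (d k) q ∧ Good (k+1) (ch k q i))
    (x y : ∀ k, Fin (N k)) (k : ℕ) (h : node ch r x k = node ch r y k) :
    ∀ j < k, x j = y j := by
  induction k with
  | zero => intro j hj; omega
  | succ k ih =>
    have h1 := node_kid M d N hM hN Good r hr ch hch x k
    have h2 := node_kid M d N hM hN Good r hr ch hch y k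
    rw [mem_kids] at h1 h2
    have h3 : node ch r x k = node ch r y k := by rw [← h1, ← h2, h]
    intro j hj
    rcases Nat.lt_succ_iff_lt_or_eq.mp hj with hj | rfl
    · exact ih h3 j hj
    · have : ch j (node ch r x j) (x j) = ch j (node ch r y j) (y j) := h
      rw [← h3] at this
      exact (hch j _ (node_good M d N hM hN Good r hr ch hch x j)).1 this

lemma node_nest (M d N : ℕ → ℕ) (hM : ∀ k, M (k+1) = M k + d k) (hN : ∀ k, 1 ≤ N k)
    (Good : ℕ → ℤ × ℤ → Prop) (r : ℤ × ℤ) (hr : Good 0 r)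
    (ch : ∀ k, ℤ × ℤ → Fin (N k) → ℤ × ℤ)
    (hch : ∀ k q, Good k q → Function.Injective (ch k q) ∧
      ∀ i, ch k q i ∈ kids (d k) q ∧ Good (k+1) (ch k q i))
    (x : ∀ k, Fin (N k)) (k j : ℕ) :
    (((node ch r x k).1:ℝ) * (1/2)^(M k) ≤ (node ch r x (k+j)).1 * (1/2)^(M (k+j)) ∧
      ((node ch r x (k+j)).1:ℝ) * (1/2)^(M (k+j)) + (1/2)^(M (k+j)) ≤ (node ch r x k).1 * (1/2)^(M k) + (1/2)^(M k)) ∧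
    (((node ch r x k).2:ℝ) * (1/2)^(M k) ≤ (node ch r x (k+j)).2 * (1/2)^(M (k+j)) ∧
      ((node ch r x (k+j)).2:ℝ) * (1/2)^(M (k+j)) + (1/2)^(M (k+j)) ≤ (node ch r x k).2 * (1/2)^(M k) + (1/2)^(M k)) := by
  induction j with
  | zero => simp
  | succ j ih =>
    have h := kid_csq (M (k+j)) (d (k+j)) _ _ (node_kid M d N hM hN Good r hr ch hch x (k+j))
    rw [← hM] at h
    rw [← add_assoc]
    exact ⟨⟨ih.1.1.trans h.1.1, h.1.2.trans ih.1.2⟩, ⟨ih.2.1.trans h.2.1, h.2.2.trans ih.2.2⟩⟩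

/-- limit point of a branch -/
noncomputable def phi (M N : ℕ → ℕ) (r : ℤ × ℤ) (ch : ∀ k, ℤ × ℤ → Fin (N k) → ℤ × ℤ) (x : ∀ k, Fin (N k)) : ℝ × ℝ :=
  (⨆ k, ((node ch r x k).1:ℝ) * (1/2)^(M k), ⨆ k, ((node ch r x k).2:ℝ) * (1/2)^(M k))

lemma phi_mem (M d N : ℕ → ℕ) (hM : ∀ k, M (k+1) = M k + d k) (hN : ∀ k, 1 ≤ N k)
    (Good : ℕ → ℤ × ℤ → Prop) (r : ℤ × ℤ) (hr : Good 0 r)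
    (ch : ∀ k, ℤ × ℤ → Fin (N k) → ℤ × ℤ)
    (hch : ∀ k q, Good k q → Function.Injective (ch k q) ∧
      ∀ i, ch k q i ∈ kids (d k) q ∧ Good (k+1) (ch k q i))
    (x : ∀ k, Fin (N k)) (k : ℕ) : phi M N r ch x ∈ csq (M k) (node ch r x k) := by
  have hn := node_nest M d N hM hN Good r hr ch hch x
  have hb1 : ∀ k j, ((node ch r x j).1:ℝ) * (1/2)^(M j) ≤ (node ch r x k).1 * (1/2)^(M k) + (1/2)^(M k) := by
    intro k j
    have hp : ∀ n, (0:ℝ) < (1/2)^(M n) := fun n => by positivity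
    rcases le_total k j with h | h
    · obtain ⟨i, rfl⟩ := Nat.exists_eq_add_of_le h
      linarith [(hn k i).1.2, hp (k+i)]
    · obtain ⟨i, rfl⟩ := Nat.exists_eq_add_of_le h
      linarith [(hn j i).1.1, hp (j+i)]
  have hb2 : ∀ k j, ((node ch r x j).2:ℝ) * (1/2)^(M j) ≤ (node ch r x k).2 * (1/2)^(M k) + (1/2)^(M k) := by
    intro k j
    have hp : ∀ n, (0:ℝ) < (1/2)^(M n) := fun n => by positivity
    rcases le_total k j with h | h
    · obtain ⟨i, rfl⟩ := Nat.exists_eq_add_of_le h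
      linarith [(hn k i).2.2, hp (k+i)]
    · obtain ⟨i, rfl⟩ := Nat.exists_eq_add_of_le h
      linarith [(hn j i).2.1, hp (j+i)]
  refine ⟨⟨?_, ?_⟩, ?_, ?_⟩
  · exact le_ciSup (f := fun k => ((node ch r x k).1:ℝ) * (1/2)^(M k))
      ⟨_, by rintro _ ⟨j, rfl⟩; exact hb1 k j⟩ k
  · exact ciSup_le fun j => hb1 k j
  · exact le_ciSup (f := fun k => ((node ch r x k).2:ℝ) * (1/2)^(M k))
      ⟨_, by rintro _ ⟨j, rfl⟩; exact hb2 k j⟩ k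
  · exact ciSup_le fun j => hb2 k j

lemma meas_node (N : ℕ → ℕ) (r : ℤ × ℤ) (ch : ∀ k, ℤ × ℤ → Fin (N k) → ℤ × ℤ) (k : ℕ) : Measurable (fun x : ∀ k, Fin (N k) => node ch r x k) := by
  induction k with
  | zero => exact measurable_const
  | succ k ih =>
    have h1 : Measurable (fun x : ∀ k, Fin (N k) => (node ch r x k, x k)) :=
      ih.prodMk (measurable_pi_apply k)
    have h2 : Measurable (fun p : (ℤ × ℤ) × Fin (N k) => ch k p.1 p.2) := Measurable.of_discrete
    exact h2.comp h1

lemma meas_phi (M N : ℕ → ℕ) (r : ℤ × ℤ) (ch : ∀ k, ℤ × ℤ → Fin (N k) → ℤ × ℤ) : Measurable (phi M N r ch) := by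
  have h1 : ∀ k, Measurable (fun x : ∀ k, Fin (N k) => ((node ch r x k).1:ℝ) * (1/2)^(M k)) := by
    intro k
    have : Measurable (fun p : ℤ × ℤ => (p.1:ℝ) * (1/2)^(M k)) := Measurable.of_discrete
    exact this.comp (meas_node N r ch k)
  have h2 : ∀ k, Measurable (fun x : ∀ k, Fin (N k) => ((node ch r x k).2:ℝ) * (1/2)^(M k)) := by
    intro k
    have : Measurable (fun p : ℤ × ℤ => (p.2:ℝ) * (1/2)^(M k)) := Measurable.of_discrete
    exact this.comp (meas_node N r ch k)
  exact (Measurable.iSup h1).prodMk (Measurable.iSup h2)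

lemma exists_measure (M d N : ℕ → ℕ) (hM : ∀ k, M (k+1) = M k + d k) (hN : ∀ k, 1 ≤ N k)
    (Good : ℕ → ℤ × ℤ → Prop) (r : ℤ × ℤ) (hr : Good 0 r)
    (ch : ∀ k, ℤ × ℤ → Fin (N k) → ℤ × ℤ)
    (hch : ∀ k q, Good k q → Function.Injective (ch k q) ∧
      ∀ i, ch k q i ∈ kids (d k) q ∧ Good (k+1) (ch k q i))
    : ∃ ν : Measure (ℝ × ℝ), 1 ≤ ν {z | ∀ k, ∃ q, Good k q ∧ z ∈ csq (M k) q} ∧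
    ∀ (z : ℝ × ℝ) (e : ℝ) (k : ℕ), (1/2)^(M k) ≤ e →
      ν (Metric.closedBall z e) ≤ ENNReal.ofReal (16 * e^2 * 4^(M k) / ∏ j ∈ Finset.range k, (N j : ℝ)) := by
  haveI : ∀ k, Nonempty (Fin (N k)) := fun k => ⟨⟨0, hN k⟩⟩
  let P : Measure (∀ k, Fin (N k)) :=
    Measure.infinitePi (fun k => ProbabilityTheory.uniformOn (Set.univ : Set (Fin (N k))))
  have hphi := meas_phi M N r ch
  have hcyl : ∀ k q, P {x | node ch r x k = q} ≤ ENNReal.ofReal (1 / ∏ j ∈ Finset.range k, (N j : ℝ)) := by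
    intro k q
    rcases Set.eq_empty_or_nonempty {x | node ch r x k = q} with h | ⟨x, hx⟩
    · rw [h]; simp
    · have hsub : {y | node ch r y k = q} ⊆ Set.pi (Finset.range k) (fun j => {x j}) := by
        intro y hy j hj
        have : node ch r y k = node ch r x k := by
          rw [show node ch r y k = q from hy, show node ch r x k = q from hx]
        exact node_inj M d N hM hN Good r hr ch hch y x k this j (by simpa using hj)
      refine (measure_mono hsub).trans ?_
      rw [Measure.infinitePi_pi _ (fun i _ => MeasurableSet.singleton _)]
      apply le_of_eq
      rw [one_div, ← Finset.prod_inv_distrib, ENNReal.ofReal_prod_of_nonneg (fun _ _ => by positivity)]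
      apply Finset.prod_congr rfl
      intro j _
      have : (0:ℝ) < N j := by exact_mod_cast hN j
      rw [ProbabilityTheory.uniformOn_univ, Measure.count_singleton, Fintype.card_fin,
        ENNReal.ofReal_inv_of_pos this, ENNReal.ofReal_natCast, one_div]
  refine ⟨P.map (phi M N r ch), ?_, ?_⟩
  · refine le_trans ?_ (Measure.le_map_apply hphi.aemeasurable _)
    have : phi M N r ch ⁻¹' {z | ∀ k, ∃ q, Good k q ∧ z ∈ csq (M k) q} = Set.univ := by
      ext x
      simp only [Set.mem_preimage, Set.mem_univ, iff_true]
      exact fun k => ⟨_, node_good M d N hM hN Good r hr ch hch x k,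
        phi_mem M d N hM hN Good r hr ch hch x k⟩
    rw [this, measure_univ]
  · intro z e k he
    rw [Measure.map_apply hphi measurableSet_closedBall]
    have he0 : 0 ≤ e := le_trans (by positivity) he
    let A := (Finset.Icc ⌈(z.1 - e) * 2^(M k) - 1⌉ ⌊(z.1 + e) * 2^(M k)⌋) ×ˢ
      (Finset.Icc ⌈(z.2 - e) * 2^(M k) - 1⌉ ⌊(z.2 + e) * 2^(M k)⌋)
    have hsub : phi M N r ch ⁻¹' Metric.closedBall z e ⊆ ⋃ q ∈ A, {x | node ch r x k = q} := by
      intro x hx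
      have hx' : dist (phi M N r ch x) z ≤ e := hx
      rw [Prod.dist_eq, max_le_iff, Real.dist_eq, Real.dist_eq, abs_le, abs_le] at hx'
      obtain ⟨⟨a1, a2⟩, a3, a4⟩ := mem_csq (phi_mem M d N hM hN Good r hr ch hch x k)
      simp only [Set.mem_iUnion]
      refine ⟨node ch r x k, Finset.mem_product.mpr ⟨?_, ?_⟩, rfl⟩
      · exact mem_meet _ _ _ _ _ a1 a2 (by linarith [hx'.1.1]) (by linarith [hx'.1.2])
      · exact mem_meet _ _ _ _ _ a3 a4 (by linarith [hx'.2.1]) (by linarith [hx'.2.2])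
    have hA : (A.card : ℝ) ≤ 16 * e^2 * 4^(M k) := by
      rw [Finset.card_product, Nat.cast_mul]
      calc _ ≤ (4 * (e * 2^(M k))) * (4 * (e * 2^(M k))) :=
            mul_le_mul (card_meet _ _ _ he) (card_meet _ _ _ he) (by positivity) (by positivity)
        _ = 16 * e^2 * (2^(M k) * 2^(M k)) := by ring
        _ = _ := by rw [← mul_pow]; norm_num
    calc _ ≤ _ := measure_mono hsub
      _ ≤ ∑ q ∈ A, P {x | node ch r x k = q} := measure_biUnion_finset_le _ _
      _ ≤ ∑ q ∈ A, ENNReal.ofReal (1 / ∏ j ∈ Finset.range k, (N j : ℝ)) :=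
          Finset.sum_le_sum fun q _ => hcyl k q
      _ = ENNReal.ofReal (A.card * (1 / ∏ j ∈ Finset.range k, (N j : ℝ))) := by
          rw [Finset.sum_const, nsmul_eq_mul, ENNReal.ofReal_mul (by positivity), ENNReal.ofReal_natCast]
      _ ≤ _ := by
          apply ENNReal.ofReal_le_ofReal
          rw [mul_one_div]
          gcongr

end MB

namespace MB
open MeasureTheory

lemma dim_lower (A : Set (ℝ × ℝ)) (ν : Measure (ℝ × ℝ)) (hA : 1 ≤ ν A) (s : NNReal) (hs : 0 < s) (e0 : ℝ) (he0 : 0 < e0)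
    (h : ∀ (z : ℝ × ℝ) (e : ℝ), 0 < e → e < e0 → ν (Metric.closedBall z e) ≤ ENNReal.ofReal (e ^ (s:ℝ))) :
    (s : ENNReal) ≤ dimH A := by
  apply le_dimH_of_hausdorffMeasure_ne_zero
  have key : ν ≤ Measure.hausdorffMeasure (s:ℝ) := by
    apply Measure.le_hausdorffMeasure (s:ℝ) ν (ENNReal.ofReal (e0/2)) (by simpa using he0)
    intro U hU
    rcases U.eq_empty_or_nonempty with rfl | ⟨z, hz⟩
    · simp
    have htop : Metric.ediam U ≠ ⊤ := ne_top_of_le_ne_top ENNReal.ofReal_ne_top hU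
    set D : ℝ := (Metric.ediam U).toReal with hD
    have hD0 : 0 ≤ D := ENNReal.toReal_nonneg
    have hDe : Metric.ediam U = ENNReal.ofReal D := (ENNReal.ofReal_toReal htop).symm
    have hDlt : D < e0 := by
      have : D ≤ e0/2 := ENNReal.toReal_le_of_le_ofReal (by positivity) hU
      linarith
    have hsub : ∀ e, D ≤ e → U ⊆ Metric.closedBall z e := by
      intro e he w hw
      have h1 := Metric.edist_le_ediam_of_mem hw hz
      rw [hDe, edist_dist, ENNReal.ofReal_le_ofReal_iff hD0] at h1
      exact Metric.mem_closedBall.mpr (h1.trans he)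
    rw [hDe, ENNReal.ofReal_rpow_of_nonneg hD0 s.coe_nonneg]
    have hlim : Tendsto (fun e : ℝ => ENNReal.ofReal (e ^ (s:ℝ))) (nhdsWithin D (Set.Ioi D)) (nhds (ENNReal.ofReal (D ^ (s:ℝ)))) := by
      have : Continuous (fun e : ℝ => ENNReal.ofReal (e ^ (s:ℝ))) :=
        ENNReal.continuous_ofReal.comp (Real.continuous_rpow_const s.coe_nonneg)
      exact (this.tendsto D).mono_left nhdsWithin_le_nhds
    refine ge_of_tendsto hlim ?_
    filter_upwards [Ioo_mem_nhdsGT hDlt] with e he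
    exact (measure_mono (hsub e he.1.le)).trans (h z e (lt_of_le_of_lt hD0 he.1) he.2)
  intro h0
  have := hA.trans (key A)
  rw [h0] at this
  simp at this

/-- scales -/
def Mk (k : ℕ) : ℕ := 40 * 24^k
/-- number of children -/
noncomputable def Nk (k : ℕ) : ℕ := ⌈(4:ℝ)^(23 * Mk k) / (64 * (24 * (Mk k : ℝ))^2)⌉₊

lemma Mk_ge (k : ℕ) : 40 ≤ Mk k := by
  unfold Mk; have := Nat.one_le_pow k 24 (by norm_num); omega
lemma Mk_succ (k : ℕ) : Mk (k+1) = 24 * Mk k := by unfold Mk; ring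
lemma Mk_mono : StrictMono Mk := strictMono_nat_of_lt_succ (fun k => by
  rw [Mk_succ]; have := Mk_ge k; omega)
lemma Mk_gt (k : ℕ) : k < Mk k := by
  induction k with
  | zero => have := Mk_ge 0; omega
  | succ n ih => rw [Mk_succ]; omega

lemma Nk_ge (k : ℕ) : 1 ≤ Nk k := by
  have : (0:ℝ) < Mk k := by exact_mod_cast (by have := Mk_ge k; omega)
  exact Nat.ceil_pos.mpr (by positivity)

lemma prod_lower (k : ℕ) : (4:ℝ)^(Mk k) ≤ 2^(80 + k*(28+10*k)) * ∏ j ∈ Finset.range k, (Nk j : ℝ) := by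
  induction k with
  | zero =>
    simp only [Mk]; norm_num
  | succ k ih =>
    rw [Finset.prod_range_succ]
    have hP : 0 ≤ ∏ j ∈ Finset.range k, (Nk j : ℝ) := Finset.prod_nonneg (fun _ _ => by positivity)
    have hM : (0:ℝ) < Mk k := by exact_mod_cast (by have := Mk_ge k; omega)
    have h1 : (4:ℝ)^(23 * Mk k) ≤ Nk k * (64 * (24 * (Mk k : ℝ))^2) := by
      rw [← div_le_iff₀ (by positivity)]; exact Nat.le_ceil _
    have h2 : 64 * (24 * (Mk k : ℝ))^2 ≤ 2^(28+10*k) := by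
      have : (24:ℝ) * Mk k ≤ 2^(11 + 5*k) := by
        have h3 : (24:ℝ)^k ≤ 2^(5*k) := by
          rw [pow_mul]; exact pow_le_pow_left₀ (by norm_num) (by norm_num) k
        simp only [Mk]; push_cast
        rw [pow_add]; nlinarith [pow_pos (show (0:ℝ) < 24 by norm_num) k]
      have h4 : (24 * (Mk k:ℝ))^2 ≤ (2^(11+5*k))^2 := pow_le_pow_left₀ (by positivity) this 2
      calc 64 * (24 * (Mk k : ℝ))^2 ≤ 64 * (2^(11+5*k))^2 := by linarith
        _ = 2^(28+10*k) := by ring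
    have e : Mk (k+1) = Mk k + 23 * Mk k := by rw [Mk_succ]; ring
    rw [e, pow_add]
    calc (4:ℝ)^(Mk k) * 4^(23*Mk k)
        ≤ (2^(80 + k*(28+10*k)) * ∏ j ∈ Finset.range k, (Nk j : ℝ)) * (Nk k * 2^(28+10*k)) := by
          apply mul_le_mul ih (h1.trans (by gcongr)) (by positivity) (by positivity)
      _ = 2^(80 + k*(28+10*k) + (28+10*k)) * ((∏ j ∈ Finset.range k, (Nk j : ℝ)) * Nk k) := by
          rw [pow_add _ (80 + k*(28+10*k))]; ring
      _ ≤ _ := by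
          apply mul_le_mul_of_nonneg_right _ (by positivity)
          apply pow_le_pow_right₀ (by norm_num)
          nlinarith

lemma growth (ε : ℝ) (hε : 0 < ε) : ∃ K0, ∀ k ≥ K0,
    16 * 4^(Mk (k+1)) / ∏ j ∈ Finset.range (k+1), (Nk j : ℝ) ≤ (2:ℝ) ^ (ε * Mk k) := by
  have ht := tendsto_pow_const_div_const_pow_of_one_lt 2 (show (1:ℝ) < 24 by norm_num)
  have ht' := (tendsto_add_atTop_iff_nat 1).mpr ht
  obtain ⟨K0, hK⟩ := eventually_atTop.mp (ht'.eventually_le_const (show (0:ℝ) < ε/120 by positivity))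
  refine ⟨K0, fun k hk => ?_⟩
  have h := hK k hk
  rw [div_le_iff₀ (by positivity)] at h
  have hP : 0 < ∏ j ∈ Finset.range (k+1), (Nk j : ℝ) :=
    Finset.prod_pos (fun j _ => by exact_mod_cast Nk_ge j)
  rw [div_le_iff₀ hP]
  calc (16:ℝ) * 4^(Mk (k+1)) ≤ 16 * (2^(80 + (k+1)*(28+10*(k+1))) * ∏ j ∈ Finset.range (k+1), (Nk j : ℝ)) := by
        gcongr; exact prod_lower (k+1)
    _ = 2^(84 + (k+1)*(28+10*(k+1))) * ∏ j ∈ Finset.range (k+1), (Nk j : ℝ) := by ring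
    _ ≤ _ := by
      gcongr
      rw [← Real.rpow_natCast]
      apply Real.rpow_le_rpow_of_exponent_le (by norm_num)
      simp only [Mk]
      push_cast at h ⊢
      rw [pow_succ (24:ℝ)] at h
      have hk0 : (0:ℝ) ≤ k := by positivity
      nlinarith

lemma ball_bound (ν : Measure (ℝ × ℝ))
    (h : ∀ (z : ℝ × ℝ) (e : ℝ) (k : ℕ), (1/2)^(Mk k) ≤ e →
      ν (Metric.closedBall z e) ≤ ENNReal.ofReal (16 * e^2 * 4^(Mk k) / ∏ j ∈ Finset.range k, (Nk j : ℝ)))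
    (ε : ℝ) (hε : 0 < ε) : ∃ e0 > 0, ∀ (z : ℝ × ℝ) (e : ℝ), 0 < e → e < e0 →
      ν (Metric.closedBall z e) ≤ ENNReal.ofReal (e ^ (2 - ε)) := by
  obtain ⟨K0, hK⟩ := growth ε hε
  refine ⟨(1/2)^(Mk K0), by positivity, fun z e he he0 => ?_⟩
  have hex : ∃ n, ((1:ℝ)/2)^(Mk n) ≤ e := by
    obtain ⟨n, hn⟩ := exists_pow_lt_of_lt_one he (show (1:ℝ)/2 < 1 by norm_num)
    exact ⟨n, (pow_le_pow_of_le_one (by norm_num) (by norm_num) (Mk_gt n).le).trans hn.le⟩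
  classical
  set n := Nat.find hex with hn
  have hn1 : ((1:ℝ)/2)^(Mk n) ≤ e := Nat.find_spec hex
  have hnK : K0 < n := by
    by_contra hle
    push Not at hle
    have : ((1:ℝ)/2)^(Mk K0) ≤ (1/2)^(Mk n) :=
      pow_le_pow_of_le_one (by norm_num) (by norm_num) (Mk_mono.monotone hle)
    linarith
  obtain ⟨k, hk⟩ : ∃ k, n = k+1 := ⟨n-1, by omega⟩
  have hlt : e < (1/2)^(Mk k) := by
    have := Nat.find_min hex (m := k) (by omega)
    push Not at this; exact this
  rw [hk] at hn1
  refine (h z e (k+1) hn1).trans (ENNReal.ofReal_le_ofReal ?_)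
  have hg := hK k (by omega)
  have h2 : (2:ℝ)^(ε * Mk k) ≤ e ^ (-ε) := by
    have : ((1/2:ℝ)^(Mk k)) ^ (-ε) ≤ e ^ (-ε) :=
      Real.rpow_le_rpow_of_nonpos he hlt.le (by linarith)
    refine le_trans (le_of_eq ?_) this
    rw [← Real.rpow_natCast, ← Real.rpow_mul (by norm_num), one_div, Real.inv_rpow (by norm_num),
      ← Real.rpow_neg (by norm_num)]
    congr 1; ring
  calc 16 * e^2 * 4^(Mk (k+1)) / ∏ j ∈ Finset.range (k+1), (Nk j : ℝ)
      = e^2 * (16 * 4^(Mk (k+1)) / ∏ j ∈ Finset.range (k+1), (Nk j : ℝ)) := by ring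
    _ ≤ e^2 * e^(-ε) := by gcongr; exact hg.trans h2
    _ = e^(2-ε) := by rw [sub_eq_add_neg, Real.rpow_add he]; norm_num

/-- the vectors avoided at stage k -/
def Bk : ℕ → Finset (ℕ × ℕ)
  | 0 => ∅
  | k+1 => block (Mk k)

lemma Bk_sub (k : ℕ) : Bk k ⊆ bigbox (2^(2 * Mk k)) := by
  cases k with
  | zero => simp [Bk]
  | succ k =>
    rw [Mk_succ, show 2 * (24 * Mk k) = 48 * Mk k by ring]
    exact Finset.filter_subset _ _

/-- good squares -/
def Gd : ℕ → ℤ × ℤ → Prop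
  | 0, _ => True
  | k+1, q => StepGood (Mk k) (Bk k) q

lemma Gd_load (k : ℕ) (q : ℤ × ℤ) (h : Gd k q) : Load (Mk k) (Bk k) q ≤ 1 / 48 * (1/4)^(Mk k) := by
  cases k with
  | zero => simp [Bk, Load]
  | succ k => rw [Mk_succ]; exact h.2.2

/-- the Cantor set -/
def KK : Set (ℝ × ℝ) := {z | ∀ k, ∃ q, Gd k q ∧ z ∈ csq (Mk k) q}

lemma dim_KK : 2 ≤ dimH KK := by
  classical
  have hch : ∀ k q, ∃ f : Fin (Nk k) → ℤ × ℤ, Gd k q →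
      Function.Injective f ∧ ∀ i, f i ∈ kids (23 * Mk k) q ∧ Gd (k+1) (f i) := by
    intro k q
    by_cases h : Gd k q
    · have hs := step (Mk k) (Mk_ge k) (Bk k) (Bk_sub k) q (Gd_load k q h)
      have hc : Nk k ≤ ((kids (23 * Mk k) q).filter (StepGood (Mk k) (Bk k))).card :=
        Nat.ceil_le.mpr (by convert hs)
      obtain ⟨f⟩ : Nonempty (Fin (Nk k) ↪ ((kids (23 * Mk k) q).filter (StepGood (Mk k) (Bk k)))) := by
        apply Function.Embedding.nonempty_of_card_le
        simpa using hc
      refine ⟨fun i => (f i).1, fun _ => ⟨Subtype.val_injective.comp f.injective, fun i => ?_⟩⟩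
      exact Finset.mem_filter.mp (f i).2
    · exact ⟨fun _ => 0, fun h' => absurd h' h⟩
  choose ch hch using hch
  obtain ⟨ν, h1, h2⟩ := exists_measure Mk (fun k => 23 * Mk k) Nk (fun k => by rw [Mk_succ]; ring) Nk_ge Gd 0
    trivial ch hch
  refine le_of_forall_lt fun c hc => ?_
  obtain ⟨s, hs1, hs2⟩ := ENNReal.lt_iff_exists_nnreal_btwn.mp hc
  refine lt_of_lt_of_le hs1 ?_
  have hs2' : (s:ℝ) < 2 := by exact_mod_cast hs2
  have hs0 : 0 < s := by
    have := lt_of_le_of_lt (zero_le) hs1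
    exact_mod_cast this
  obtain ⟨e0, he0, hb⟩ := ball_bound ν h2 (2 - s) (by linarith)
  refine dim_lower KK ν h1 s hs0 e0 he0 ?_
  intro z e he hle
  have := hb z e he hle
  rwa [show (2:ℝ) - (2 - s) = s by ring] at this

end MB

namespace MB
open MeasureTheory

lemma KK_hit (z : ℝ × ℝ) (hz : z ∈ KK) (k : ℕ) :
    (∀ v ∈ Bk k, dl (Mk k) v < nint (v.1 * z.1 + v.2 * z.2)) ∧
    ∃ v ∈ V0 (2^(7*Mk k)), nint (v.1 * z.1 + v.2 * z.2) ≤ 3 * tau (Mk k) := by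
  obtain ⟨q, hq, hzq⟩ := hz (k+1)
  rw [Mk_succ] at hzq
  obtain ⟨h1, ⟨v, hv, h2⟩, -⟩ := hq
  exact ⟨fun v hv => h1 v hv z hzq, v, hv, h2 z hzq⟩

/-- the function whose liminf is taken -/
noncomputable def F (z : ℝ × ℝ) (xy : ℕ × ℕ) : ℝ :=
  max 2 (xy.1 * xy.2 : ℝ) * nint (xy.1 * z.1 + xy.2 * z.2) * (Real.log (max 2 (xy.1 * xy.2 : ℝ))) ^ 2

lemma F_lower (z : ℝ × ℝ) (hz : z ∈ KK) (v : ℕ × ℕ) (hv : (2^(2 * Mk 0))^2 < v.1 * v.2) :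
    (1/10000000) * (1/24)^2 ≤ F z v := by
  have hpos : 0 < v.1 * v.2 := by omega
  have hx : 0 < v.1 := Nat.pos_of_mul_pos_right hpos
  have hy : 0 < v.2 := Nat.pos_of_mul_pos_left hpos
  have hmax : 2^(2*Mk 0) < max v.1 v.2 := by
    by_contra h
    push Not at h
    have h1 := (le_max_left v.1 v.2).trans h
    have h2 := (le_max_right v.1 v.2).trans h
    have := Nat.mul_le_mul h1 h2
    rw [← pow_two] at this
    omega
  have hex : ∃ n, max v.1 v.2 ≤ 2^(2 * Mk n) := by
    refine ⟨max v.1 v.2, ?_⟩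
    have h1 := Mk_gt (max v.1 v.2)
    have h2 := Nat.lt_two_pow_self (n := 2 * Mk (max v.1 v.2))
    omega
  classical
  set n := Nat.find hex with hn
  have hn1 : max v.1 v.2 ≤ 2^(2 * Mk n) := Nat.find_spec hex
  have hn0 : n ≠ 0 := by
    intro h; rw [h] at hn1; omega
  obtain ⟨k, hk⟩ : ∃ k, n = k+1 := ⟨n-1, by omega⟩
  have hlt : 2^(2*Mk k) < max v.1 v.2 := by
    have := Nat.find_min hex (m := k) (by omega)
    push Not at this; exact this
  rw [hk, Mk_succ, show 2 * (24 * Mk k) = 48 * Mk k by ring] at hn1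
  have hmem : v ∈ Bk (k+1) := by
    refine Finset.mem_filter.mpr ⟨Finset.mem_product.mpr ⟨?_, ?_⟩, hlt⟩
    · exact Finset.mem_Icc.mpr ⟨hx, (le_max_left _ _).trans hn1⟩
    · exact Finset.mem_Icc.mpr ⟨hy, (le_max_right _ _).trans hn1⟩
  have h := (KK_hit z hz (k+1)).1 v hmem
  have hge : max v.1 v.2 ≤ v.1 * v.2 := max_le (Nat.le_mul_of_pos_right _ hy) (Nat.le_mul_of_pos_left _ hx)
  have hbig : (2:ℝ)^(2*Mk k) ≤ (v.1:ℝ) * v.2 := by exact_mod_cast hlt.le.trans hge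
  have hM40 := Mk_ge k
  have h2 : (2:ℝ) ≤ (v.1:ℝ) * v.2 := by
    refine le_trans ?_ hbig
    calc (2:ℝ) = 2^1 := by norm_num
      _ ≤ _ := pow_le_pow_right₀ (by norm_num) (by omega)
  have hM : (0:ℝ) < Mk k := by exact_mod_cast (by omega)
  have hlog : (Mk k : ℝ) ≤ Real.log ((v.1:ℝ) * v.2) := by
    have h3 : Real.log ((2:ℝ)^(2*Mk k)) ≤ Real.log ((v.1:ℝ) * v.2) := Real.log_le_log (by positivity) hbig
    rw [Real.log_pow] at h3
    push_cast at h3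
    have := Real.log_two_gt_d9
    nlinarith
  unfold F
  rw [max_eq_right h2]
  have hP : 0 < (v.1:ℝ) * v.2 := by linarith
  calc (1/10000000:ℝ) * (1/24)^2 = ((v.1:ℝ) * v.2) * dl (Mk (k+1)) v * (Mk k)^2 := by
        unfold dl; rw [Mk_succ]; push_cast
        field_simp
        try norm_num
    _ ≤ _ := by
        have := nint_nonneg (v.1 * z.1 + v.2 * z.2)
        gcongr

lemma F_upper (z : ℝ × ℝ) (hz : z ∈ KK) (k : ℕ) : ∃ v : ℕ × ℕ, k ≤ v.1 * v.2 ∧ F z v ≤ 12 := by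
  obtain ⟨v, hv, hn⟩ := (KK_hit z hz k).2
  obtain ⟨⟨a1, a2⟩, b1, b2⟩ := mem_V0.mp hv
  have hM40 := Mk_ge k
  set m := Mk k with hm
  have hk := Mk_gt k
  have hh1 : m < 2^(7*m) := by have := Nat.lt_two_pow_self (n := 7*m); omega
  set h := 2^(7*m) with hh
  have hp : 0 < h := by positivity
  refine ⟨v, ?_, ?_⟩
  · nlinarith
  have hM : (40:ℝ) ≤ m := by exact_mod_cast hM40
  have hhR : (h:ℝ) = 2^(7*m) := by rw [hh]; push_cast; rfl
  have hR : (40:ℝ) ≤ h := hM.trans (by exact_mod_cast hh1.le)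
  have c1 : (h:ℝ) ≤ v.1 := by exact_mod_cast a1
  have c2 : (v.1:ℝ) ≤ 2*h := by exact_mod_cast a2.le
  have d1 : (h:ℝ) ≤ v.2 := by exact_mod_cast b1
  have d2 : (v.2:ℝ) ≤ 2*h := by exact_mod_cast b2.le
  have hlo : (2:ℝ) ≤ (v.1:ℝ) * v.2 := by nlinarith
  have hhi : (v.1:ℝ) * v.2 ≤ 4*(h:ℝ)^2 := by nlinarith
  have hlog : Real.log ((v.1:ℝ) * v.2) ≤ 24*m := by
    have h3 : Real.log ((v.1:ℝ) * v.2) ≤ Real.log ((2:ℝ)^(14*m+2)) := by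
      apply Real.log_le_log (by linarith)
      refine hhi.trans (le_of_eq ?_)
      rw [hhR]; ring
    rw [Real.log_pow] at h3
    push_cast at h3
    have := Real.log_two_lt_d9
    nlinarith
  have hl0 : 0 ≤ Real.log ((v.1:ℝ) * v.2) := Real.log_nonneg (by linarith)
  unfold F
  rw [max_eq_right hlo]
  calc (v.1:ℝ) * v.2 * nint (v.1 * z.1 + v.2 * z.2) * Real.log ((v.1:ℝ) * v.2) ^ 2
      ≤ (4*(h:ℝ)^2) * (3 * tau m) * (24*m)^2 := by
        have := nint_nonneg (v.1 * z.1 + v.2 * z.2)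
        have ht := tau_pos m (by omega)
        gcongr
    _ = 12 := by
        unfold tau; rw [← hhR]; field_simp; try norm_num

lemma F_liminf (z : ℝ × ℝ) (hz : z ∈ KK) :
    0 < liminf (F z) (comap (fun xy : ℕ × ℕ => xy.1 * xy.2) atTop) := by
  have hlow : ∀ᶠ v in comap (fun xy : ℕ × ℕ => xy.1 * xy.2) atTop, (1/10000000:ℝ) * (1/24)^2 ≤ F z v := by
    have : ∀ᶠ n : ℕ in atTop, (2^(2 * Mk 0))^2 < n := eventually_gt_atTop _
    filter_upwards [this.comap (fun xy : ℕ × ℕ => xy.1 * xy.2)] with v hv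
    exact F_lower z hz v hv
  refine lt_of_lt_of_le (b := (1/10000000:ℝ) * (1/24)^2) (by norm_num) ?_
  refine le_liminf_of_le ?_ hlow
  apply IsCoboundedUnder.of_frequently_le (a := 12)
  intro hev
  obtain ⟨t, ht, hsub⟩ := mem_comap.mp hev
  obtain ⟨n, hn⟩ := mem_atTop_sets.mp ht
  obtain ⟨v, hv, hle⟩ := F_upper z hz n
  exact hsub (hn _ hv) hle

end MB

theorem stmt_14 :
    dimH {pr : ℝ × ℝ |
      0 < Filter.liminf
        (fun xy : ℕ × ℕ =>
          max 2 (xy.1 * xy.2 : ℝ) * nint (xy.1 * pr.1 + xy.2 * pr.2) *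
            (Real.log (max 2 (xy.1 * xy.2 : ℝ))) ^ 2)
        (Filter.comap (fun xy : ℕ × ℕ => xy.1 * xy.2) atTop)} = 2 := by
  apply le_antisymm
  · refine (dimH_mono (Set.subset_univ _)).trans ?_
    rw [Real.dimH_univ_eq_finrank]
    simp
  · exact MB.dim_KK.trans (dimH_mono (fun z hz => MB.F_liminf z hz))
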